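/- Let G be an essentially 4-connected plane graph on n ≥ 16 vertices, let C be an isolating cycle of G, and assume |V⁻| ≥ 1 and |V⁺| ≥ 1. Then |M⁻ ∪ M⁺| ≥ |V⁻ ∪ V⁺| + 4. -/

import Mathlib

open scoped Classical

noncomputable section

/-- A plane embedding (drawing) of a simple graph: vertices are mapped to distinct
points of the plane, every edge is drawn as a simple arc joining the points of its two
endvertices, arcs contain no vertex points other than their endpoints, and two distinct
arcs meet only in common endpoints. -/
structure PlaneEmbedding {V : Type*} (G : SimpleGraph V) where
  pos : V → ℝ × ℝ
  arc : V → V → Set (ℝ × ℝ)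
  pos_injective : Function.Injective pos
  arc_symm : ∀ u v, arc u v = arc v u
  arc_curve : ∀ u v, G.Adj u v → ∃ γ : ℝ → ℝ × ℝ,
      ContinuousOn γ (Set.Icc 0 1) ∧ Set.InjOn γ (Set.Icc 0 1) ∧
      γ 0 = pos u ∧ γ 1 = pos v ∧ γ '' Set.Icc 0 1 = arc u v
  arc_vertex : ∀ u v, G.Adj u v → ∀ w, pos w ∈ arc u v → w = u ∨ w = v
  arc_inter : ∀ u v x y, G.Adj u v → G.Adj x y → s(u, v) ≠ s(x, y) →
      arc u v ∩ arc x y ⊆ Set.range pos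

/-- A graph is planar if it admits a plane embedding. -/
def SimpleGraph.IsPlanar {V : Type*} (G : SimpleGraph V) : Prop :=
  Nonempty (PlaneEmbedding G)

/-- A graph is 3-connected if it has at least four vertices and deleting any set of at
most two vertices leaves a connected graph. -/
def ThreeConnected {V : Type*} [Fintype V] (G : SimpleGraph V) : Prop :=
  4 ≤ Fintype.card V ∧
    ∀ S : Finset V, S.card ≤ 2 → (G.induce ((↑S : Set V)ᶜ)).Connected

/-- `S` is a separator of `G`: deleting it leaves a disconnected graph. -/
def IsSeparator {V : Type*} [Fintype V] (G : SimpleGraph V) (S : Finset V) : Prop :=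
  ¬ (G.induce ((↑S : Set V)ᶜ)).Connected

/-- A separator `S` is trivial if some component of `G - S` is a single vertex, i.e.
some vertex outside `S` has all of its neighbours inside `S`. -/
def TrivialSeparator {V : Type*} [Fintype V] (G : SimpleGraph V) (S : Finset V) : Prop :=
  ∃ v : V, v ∉ S ∧ ∀ w : V, G.Adj v w → w ∈ S

/-- A graph is essentially 4-connected if it is 3-connected and every 3-separator is
trivial. -/
def EssentiallyFourConnected {V : Type*} [Fintype V] (G : SimpleGraph V) : Prop :=
  ThreeConnected G ∧
    ∀ S : Finset V, S.card = 3 → IsSeparator G S → TrivialSeparator G S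

/-- A cycle `C` of `G` is isolating if every component of `G - V(C)` is a single vertex
of degree 3 in `G`, i.e. every vertex not on `C` has degree 3 in `G` and all of its
neighbours on `C`. -/
def IsIsolating {V : Type*} [Fintype V] (G : SimpleGraph V) {x : V} (C : G.Walk x x) : Prop :=
  ∀ v : V, v ∉ C.support →
    (Finset.univ.filter fun w => G.Adj v w).card = 3 ∧ ∀ w : V, G.Adj v w → w ∈ C.support

/-- `C` is a longest isolating cycle of `G`. -/
def IsLongestIsolatingCycle {V : Type*} [Fintype V] (G : SimpleGraph V) {x : V}
    (C : G.Walk x x) : Prop :=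
  C.IsCycle ∧ IsIsolating G C ∧
    ∀ (y : V) (C' : G.Walk y y), C'.IsCycle → IsIsolating G C' → C'.length ≤ C.length

section PlaneSetup

variable {V : Type*} [Fintype V] {G : SimpleGraph V}

/-- The chords of the cycle `C`: edges of `G` not on `C` joining two vertices of `C`. -/
def chordSet {x : V} (C : G.Walk x x) : Set (Sym2 V) :=
  {e | e ∈ G.edgeSet ∧ e ∉ C.edges ∧ ∀ v ∈ e, v ∈ C.support}

/-- The plane graph `H` obtained from `G` by deleting all chords of `C`. -/
def Hgraph {x : V} (C : G.Walk x x) : SimpleGraph V :=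
  G.deleteEdges (chordSet C)

/-- The arc drawing an edge, as a function of the unordered edge. -/
def arcSet (emb : PlaneEmbedding G) : Sym2 V → Set (ℝ × ℝ) :=
  Sym2.lift ⟨emb.arc, emb.arc_symm⟩

/-- The point set of the drawing of the subgraph of `H'` induced on the vertex set `s`
(in the embedding `emb` of `G`). -/
def drawingOn (emb : PlaneEmbedding G) (H' : SimpleGraph V) (s : Set V) : Set (ℝ × ℝ) :=
  emb.pos '' s ∪
    ⋃ (u : V) (v : V) (_ : H'.Adj u v) (_ : u ∈ s) (_ : v ∈ s), emb.arc u v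

/-- The drawing of `H`. -/
def drawingH (emb : PlaneEmbedding G) {x : V} (C : G.Walk x x) : Set (ℝ × ℝ) :=
  drawingOn emb (Hgraph C) Set.univ

/-- `f` is a face of the drawing `D`: a connected component of its complement. -/
def IsFaceOf (D : Set (ℝ × ℝ)) (f : Set (ℝ × ℝ)) : Prop :=
  ∃ z : ℝ × ℝ, z ∉ D ∧ f = connectedComponentIn Dᶜ z

/-- The drawing of the cycle `C`. -/
def drawC (emb : PlaneEmbedding G) {x : V} (C : G.Walk x x) : Set (ℝ × ℝ) :=
  ⋃ e ∈ C.edges, arcSet emb e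

/-- The open region strictly inside the closed curve given by `C`: the points off the
curve whose connected component in the complement is bounded. -/
def insideC (emb : PlaneEmbedding G) {x : V} (C : G.Walk x x) : Set (ℝ × ℝ) :=
  {z | z ∉ drawC emb C ∧ Bornology.IsBounded (connectedComponentIn (drawC emb C)ᶜ z)}

/-- The vertices of `G` strictly inside `C`. -/
def Vminus (emb : PlaneEmbedding G) {x : V} (C : G.Walk x x) : Finset V :=
  Finset.univ.filter fun v => v ∉ C.support ∧ emb.pos v ∈ insideC emb C

/-- The vertices of `G` strictly outside `C`:  `V⁺ = V - V(C) - V⁻`. -/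
def Vplus (emb : PlaneEmbedding G) {x : V} (C : G.Walk x x) : Finset V :=
  Finset.univ.filter fun v => v ∉ C.support ∧ v ∉ Vminus emb C

/-- A face `f` is incident with the vertex `v`. -/
def incVertex (emb : PlaneEmbedding G) (f : Set (ℝ × ℝ)) (v : V) : Prop :=
  emb.pos v ∈ closure f

/-- A face `f` is incident with the edge `e` (the arc of `e` lies on the boundary). -/
def incEdge (emb : PlaneEmbedding G) (f : Set (ℝ × ℝ)) (e : Sym2 V) : Prop :=
  arcSet emb e ⊆ closure f

/-- A minor face of the drawing `D`: a face incident with exactly one vertex of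
`V⁻ ∪ V⁺`. -/
def MinorFaceOf (emb : PlaneEmbedding G) {x : V} (C : G.Walk x x)
    (D : Set (ℝ × ℝ)) (f : Set (ℝ × ℝ)) : Prop :=
  IsFaceOf D f ∧ ∃! v : V, v ∈ Vminus emb C ∪ Vplus emb C ∧ incVertex emb f v

/-- `M⁻`: the minor faces of `H⁻ = H - V⁺`. -/
def Mminus (emb : PlaneEmbedding G) {x : V} (C : G.Walk x x) : Set (Set (ℝ × ℝ)) :=
  {f | MinorFaceOf emb C (drawingOn emb (Hgraph C) ((↑(Vplus emb C) : Set V)ᶜ)) f}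

/-- `M⁺`: the minor faces of `H⁺ = H - V⁻`. -/
def Mplus (emb : PlaneEmbedding G) {x : V} (C : G.Walk x x) : Set (Set (ℝ × ℝ)) :=
  {f | MinorFaceOf emb C (drawingOn emb (Hgraph C) ((↑(Vminus emb C) : Set V)ᶜ)) f}

/-- A minor face of `H`. -/
def MinorFaceH (emb : PlaneEmbedding G) {x : V} (C : G.Walk x x) (f : Set (ℝ × ℝ)) : Prop :=
  MinorFaceOf emb C (drawingH emb C) f

/-- A major face of `H`: a face of `H` that is not minor. -/
def MajorFaceH (emb : PlaneEmbedding G) {x : V} (C : G.Walk x x) (f : Set (ℝ × ℝ)) : Prop :=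
  IsFaceOf (drawingH emb C) f ∧ ¬ MinorFaceH emb C f

/-- The number of `C`-edges of a face `f` (so `f` is a `j`-face when this equals `j`). -/
def numCEdges (emb : PlaneEmbedding G) {x : V} (C : G.Walk x x) (f : Set (ℝ × ℝ)) : ℕ :=
  (C.edges.toFinset.filter fun e => incEdge emb f e).card

/-- `m_{f,f'}`: the number of common `C`-edges of the faces `f` and `f'`. -/
def mEdges (emb : PlaneEmbedding G) {x : V} (C : G.Walk x x)
    (f f' : Set (ℝ × ℝ)) : ℕ :=
  (C.edges.toFinset.filter fun e => incEdge emb f e ∧ incEdge emb f' e).card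

/-- `f'` is opposite to `f` (with respect to some `C`-edge incident with both). -/
def OppositeFaces (emb : PlaneEmbedding G) {x : V} (C : G.Walk x x)
    (f f' : Set (ℝ × ℝ)) : Prop :=
  f ≠ f' ∧ ∃ e ∈ C.edges, incEdge emb f e ∧ incEdge emb f' e

/-- `e` is the middle `C`-edge of the face `f` (for a 3-face, the `C`-edge sharing an
endvertex with every other `C`-edge of `f`). -/
def IsMiddleCEdge (emb : PlaneEmbedding G) {x : V} (C : G.Walk x x)
    (f : Set (ℝ × ℝ)) (e : Sym2 V) : Prop :=
  e ∈ C.edges ∧ incEdge emb f e ∧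
    ∀ e' ∈ C.edges, incEdge emb f e' → e' ≠ e → ∃ v : V, v ∈ e ∧ v ∈ e'

/-- The total weight sent from the face `f` to the face `f'` by the discharging rules
R1–R5 (each rule applied exactly once). -/
def sendWeight (emb : PlaneEmbedding G) {x : V} (C : G.Walk x x)
    (f f' : Set (ℝ × ℝ)) : ℚ :=
  -- R1: a major face sends `m_{f,f'}` to every opposite minor face
  (if MajorFaceH emb C f ∧ MinorFaceH emb C f' ∧ OppositeFaces emb C f f'
    then (mEdges emb C f f' : ℚ) else 0)
  -- R2: a minor face sends `(2/3)·m_{f,f'}` to every opposite minor 2-face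
  + (if MinorFaceH emb C f ∧ MinorFaceH emb C f' ∧ numCEdges emb C f' = 2 ∧
        OppositeFaces emb C f f'
    then 2 / 3 * (mEdges emb C f f' : ℚ) else 0)
  -- R3: a minor face sends 1 to every minor 3-face opposite with respect to its middle
  -- `C`-edge
  + (if MinorFaceH emb C f ∧ MinorFaceH emb C f' ∧ numCEdges emb C f' = 3 ∧ f ≠ f' ∧
        (∃ e : Sym2 V, IsMiddleCEdge emb C f' e ∧ incEdge emb f e)
    then 1 else 0)
  -- R4
  + (if MinorFaceH emb C f ∧ 4 ≤ numCEdges emb C f ∧ MinorFaceH emb C f' ∧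
        numCEdges emb C f' = 4 ∧ OppositeFaces emb C f' f ∧ mEdges emb C f' f = 2 ∧
        (∃ f₂ : Set (ℝ × ℝ), MinorFaceH emb C f₂ ∧
          (numCEdges emb C f₂ = 2 ∨ numCEdges emb C f₂ = 3) ∧
          OppositeFaces emb C f' f₂ ∧ mEdges emb C f' f₂ = 2)
    then 2 / 3 else 0)
  -- R5
  + (if MinorFaceH emb C f ∧ 4 ≤ numCEdges emb C f ∧ MinorFaceH emb C f' ∧
        numCEdges emb C f' = 5 ∧ OppositeFaces emb C f' f ∧ mEdges emb C f' f = 2 ∧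
        (∃ g₁ g₂ : Set (ℝ × ℝ), g₁ ≠ g₂ ∧
          MinorFaceH emb C g₁ ∧ numCEdges emb C g₁ = 2 ∧ OppositeFaces emb C f' g₁ ∧
          MinorFaceH emb C g₂ ∧ numCEdges emb C g₂ = 2 ∧ OppositeFaces emb C f' g₂)
    then 1 / 3 else 0)

/-- The final weight of a face `f` after discharging: the initial charge `j` of a
`j`-face, minus everything sent, plus everything received. -/
def wFace (emb : PlaneEmbedding G) {x : V} (C : G.Walk x x) (f : Set (ℝ × ℝ)) : ℚ :=
  (numCEdges emb C f : ℚ) - (∑ᶠ f' : Set (ℝ × ℝ), sendWeight emb C f f')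
    + ∑ᶠ f' : Set (ℝ × ℝ), sendWeight emb C f' f

end PlaneSetup

namespace PlaneTopology

open Set Topology

/-- The identification of the real plane with `ℂ`. -/
def pt : (ℝ × ℝ) ≃ₜ ℂ := Complex.equivRealProdCLM.toHomeomorph.symm

lemma continuous_pt : Continuous pt := pt.continuous

lemma pt_sub_ne_zero {z p : ℝ × ℝ} (h : z ≠ p) : pt z - pt p ≠ 0 :=
  sub_ne_zero.2 fun e => h (pt.injective e)

/-- `f` has a continuous logarithm on `K`. -/
def HasLog {X : Type*} [TopologicalSpace X] (K : Set X) (f : X → ℂ) : Prop :=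
  ∃ g : X → ℂ, ContinuousOn g K ∧ ∀ z ∈ K, Complex.exp (g z) = f z

section HasLog

variable {X : Type*} [TopologicalSpace X] {K L : Set X} {f f' : X → ℂ}

lemma HasLog.mono (h : HasLog K f) (hL : L ⊆ K) : HasLog L f := by
  obtain ⟨g, hg, e⟩ := h
  exact ⟨g, hg.mono hL, fun z hz => e z (hL hz)⟩

lemma HasLog.congr (h : HasLog K f) (hf : ∀ z ∈ K, f z = f' z) : HasLog K f' := by
  obtain ⟨g, hg, e⟩ := h
  exact ⟨g, hg, fun z hz => (e z hz).trans (hf z hz)⟩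

lemma HasLog.mul (h : HasLog K f) (h' : HasLog K f') : HasLog K (fun z => f z * f' z) := by
  obtain ⟨g, hg, e⟩ := h
  obtain ⟨g', hg', e'⟩ := h'
  exact ⟨fun z => g z + g' z, hg.add hg', fun z hz => by rw [Complex.exp_add, e z hz, e' z hz]⟩

lemma HasLog.inv (h : HasLog K f) : HasLog K (fun z => (f z)⁻¹) := by
  obtain ⟨g, hg, e⟩ := h
  exact ⟨fun z => - g z, hg.neg, fun z hz => by rw [Complex.exp_neg, e z hz]⟩

lemma hasLog_of_mem_slitPlane (hf : ContinuousOn f K) (h : ∀ z ∈ K, f z ∈ Complex.slitPlane) :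
    HasLog K f :=
  ⟨fun z => Complex.log (f z), hf.clog h,
    fun z hz => Complex.exp_log (Complex.slitPlane_ne_zero (h z hz))⟩

lemma hasLog_univ [SimplyConnectedSpace X] [LocallyPathConnectedSpace X]
    (hf : Continuous f) (h : ∀ z, f z ≠ 0) : HasLog univ f := by
  obtain ⟨x₀⟩ : Nonempty X := inferInstance
  obtain ⟨F, ⟨-, hF⟩, -⟩ := Complex.isCoveringMapOn_exp.existsUnique_continuousMap_lifts
    ⟨f, hf⟩ (Complex.exp_log (h x₀)) (fun x => h x)
  exact ⟨F, F.continuous.continuousOn, fun z _ => congrFun hF z⟩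

/-- Two logarithms of the same function differ by a constant on a preconnected set. -/
lemma exp_eq_one_const (hK : IsPreconnected K) {u : X → ℂ} (hu : ContinuousOn u K)
    (h : ∀ z ∈ K, Complex.exp (u z) = 1) : ∃ n : ℤ, ∀ z ∈ K, u z = n * (2 * Real.pi * Complex.I) := by
  rcases K.eq_empty_or_nonempty with rfl | ⟨z₀, hz₀⟩
  · exact ⟨0, by simp⟩
  have hpi : (2 * Real.pi * Complex.I : ℂ) ≠ 0 := Complex.two_pi_I_ne_zero
  have hd : DiscreteTopology (range ((↑) : ℤ → ℝ)) :=
    Int.isClosedEmbedding_coe_real.isEmbedding.toHomeomorph.symm.isEmbedding.discreteTopology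
  have hint : ∀ z ∈ K, ∃ n : ℤ, u z = n * (2 * Real.pi * Complex.I) :=
    fun z hz => Complex.exp_eq_one_iff.1 (h z hz)
  have hre : ∀ z ∈ K, ∀ n : ℤ, u z = n * (2 * Real.pi * Complex.I) →
      (u z / (2 * Real.pi * Complex.I)).re = n := by
    intro z _ n hn
    rw [hn, mul_div_cancel_right₀ _ hpi, Complex.intCast_re]
  obtain ⟨n, hn⟩ := hint z₀ hz₀
  refine ⟨n, fun z hz => ?_⟩
  obtain ⟨m, hm⟩ := hint z hz
  have hc : ContinuousOn (fun z => (u z / (2 * Real.pi * Complex.I)).re) K :=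
    Complex.continuous_re.comp_continuousOn (hu.div_const _)
  have := hK.constant_of_mapsTo (T := range ((↑) : ℤ → ℝ)) ⟨hd⟩ hc
    (fun z hz => by obtain ⟨m, hm⟩ := hint z hz; exact ⟨m, (hre z hz m hm).symm⟩) hz hz₀
  simp only [hre z hz m hm, hre z₀ hz₀ n hn, Int.cast_inj] at this
  rw [hm, this]

/-- Gluing logarithms along a constant difference. -/
lemma hasLog_union_of_const {g g' : X → ℂ} (hKL : (IsClosed K ∧ IsClosed L) ∨ (IsOpen K ∧ IsOpen L))
    (hg : ContinuousOn g K) (e : ∀ z ∈ K, Complex.exp (g z) = f z)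
    (hg' : ContinuousOn g' L) (e' : ∀ z ∈ L, Complex.exp (g' z) = f z)
    (h : ∃ n : ℤ, ∀ z ∈ K ∩ L, g z - g' z = n * (2 * Real.pi * Complex.I)) :
    HasLog (K ∪ L) f := by
  obtain ⟨n, hn⟩ := h
  let G : X → ℂ := fun z => if z ∈ K then g z else g' z + n * (2 * Real.pi * Complex.I)
  have hGK : ∀ z ∈ K, G z = g z := fun z hz => if_pos hz
  have hGL : ∀ z ∈ L, G z = g' z + n * (2 * Real.pi * Complex.I) := by
    intro z hz
    by_cases hzK : z ∈ K
    · rw [hGK z hzK, ← hn z ⟨hzK, hz⟩]; ring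
    · exact if_neg hzK
  have cK : ContinuousOn G K := hg.congr hGK
  have cL : ContinuousOn G L := (hg'.add continuousOn_const).congr hGL
  refine ⟨G, ?_, ?_⟩
  · rcases hKL with ⟨h1, h2⟩ | ⟨h1, h2⟩
    · exact cK.union_of_isClosed cL h1 h2
    · exact cK.union_of_isOpen cL h1 h2
  · rintro z (hz | hz)
    · rw [hGK z hz, e z hz]
    · rw [hGL z hz, Complex.exp_add, e' z hz, Complex.exp_int_mul_two_pi_mul_I, mul_one]

lemma HasLog.union (hKL : (IsClosed K ∧ IsClosed L) ∨ (IsOpen K ∧ IsOpen L))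
    (hc : IsPreconnected (K ∩ L)) (hK : HasLog K f) (hL : HasLog L f) : HasLog (K ∪ L) f := by
  obtain ⟨g, hg, e⟩ := hK
  obtain ⟨g', hg', e'⟩ := hL
  refine hasLog_union_of_const hKL hg e hg' e' (exp_eq_one_const hc
    ((hg.mono inter_subset_left).sub (hg'.mono inter_subset_right)) fun z hz => ?_)
  rw [Complex.exp_sub, e z hz.1, e' z hz.2, div_self]
  rw [← e z hz.1]; exact Complex.exp_ne_zero _

end HasLog

/-- The point at angle `t` on the circle of radius `r` around `p`. -/
def circ (p : ℝ × ℝ) (r t : ℝ) : ℝ × ℝ := pt.symm (pt p + r * Complex.exp (t * Complex.I))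

lemma continuous_circ (p : ℝ × ℝ) : Continuous fun x : ℝ × ℝ => circ p x.1 x.2 :=
  pt.symm.continuous.comp (by fun_prop)

lemma pt_circ (p : ℝ × ℝ) (r t : ℝ) : pt (circ p r t) - pt p = r * Complex.exp (t * Complex.I) := by
  simp [circ]

lemma norm_pt_circ (p : ℝ × ℝ) {r : ℝ} (hr : 0 ≤ r) (t : ℝ) : ‖pt (circ p r t) - pt p‖ = r := by
  rw [pt_circ, norm_mul, Complex.norm_exp_ofReal_mul_I, mul_one, Complex.norm_real,
    Real.norm_of_nonneg hr]

/-- Nonzero powers of the identity have no logarithm on a circle. -/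
lemma not_hasLog_circle {p : ℝ × ℝ} {r : ℝ} (hr : 0 < r) {c : ℤ} (hc : c ≠ 0) :
    ¬ HasLog {z | ‖pt z - pt p‖ = r} (fun z => (pt z - pt p) ^ c) := by
  rintro ⟨g, hg, e⟩
  have hmem : ∀ t, circ p r t ∈ {z | ‖pt z - pt p‖ = r} := fun t => norm_pt_circ p hr.le t
  have hr' : (r : ℂ) ≠ 0 := by exact_mod_cast hr.ne'
  let u : ℝ → ℂ := fun t => g (circ p r t) - (c * Complex.log r + c * (t * Complex.I))
  have hu : ContinuousOn u univ := by
    refine ContinuousOn.sub (hg.comp (Continuous.continuousOn ?_) fun t _ => hmem t)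
      (by fun_prop)
    exact (continuous_circ p).comp (by fun_prop : Continuous fun t : ℝ => (r, t))
  obtain ⟨n, hn⟩ := exp_eq_one_const isPreconnected_univ hu (fun t _ => by
    have h1 := e _ (hmem t)
    simp only [u, Complex.exp_sub, h1, Complex.exp_add, Complex.exp_int_mul, pt_circ,
      Complex.exp_log hr', mul_zpow]
    exact div_self (mul_ne_zero (zpow_ne_zero _ hr') (zpow_ne_zero _ (Complex.exp_ne_zero _))))
  have h0 := hn 0 trivial
  have h1 := hn (2 * Real.pi) trivial
  have hcirc : circ p r (2 * Real.pi) = circ p r 0 := by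
    simp [circ, Complex.exp_two_pi_mul_I]
  simp only [u, hcirc] at h0 h1
  have : (c : ℂ) * (2 * Real.pi * Complex.I) = 0 := by
    have h2 := h0.trans h1.symm
    push_cast at h2
    linear_combination h2
  rcases mul_eq_zero.1 this with h | h
  · exact hc (by exact_mod_cast h)
  · exact Complex.two_pi_I_ne_zero h

/-- The main obstruction: a function winding around a point of a bounded region has no logarithm
on the boundary of the region. -/
lemma not_hasLog_of_bounded {K U : Set (ℝ × ℝ)} {p : ℝ × ℝ} {h : ℝ × ℝ → ℂ} {c : ℤ} (hc : c ≠ 0)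
    (hK : IsClosed K) (hU : IsOpen U) (hb : Bornology.IsBounded U) (hf : frontier U ⊆ K)
    (hp : p ∈ U) (hh : ContinuousOn h (closure U)) (hh0 : ∀ z ∈ closure U, h z ≠ 0) :
    ¬ HasLog K (fun z => (pt z - pt p) ^ c * h z) := by
  rintro ⟨g, hg, e⟩
  obtain ⟨G, hG⟩ := ContinuousMap.exists_restrict_eq hK ⟨K.domRestrict g, hg.domRestrict⟩
  have hGK : ∀ z ∈ K, G z = g z := fun z hz => congrArg (fun f => f ⟨z, hz⟩) hG
  let φ : ℝ × ℝ → ℂ := fun z => if z ∈ U then Complex.exp (G z) / h z else (pt z - pt p) ^ c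
  have hφ : Continuous φ := by
    rw [← continuousOn_univ]
    refine ContinuousOn.if ?_ ?_ ?_
    · rintro z ⟨-, hz⟩
      have hz' : z ∈ frontier U := hz
      rw [hGK z (hf hz'), e z (hf hz'), mul_div_cancel_right₀ _ (hh0 z hz'.1)]
    · refine ContinuousOn.div (by fun_prop) (hh.mono ?_) fun z hz => hh0 z hz.2
      exact fun z hz => hz.2
    · intro z hz
      have hz' : z ∈ Uᶜ := by
        have := hz.2
        rwa [show {a | a ∉ U} = Uᶜ from rfl, hU.isClosed_compl.closure_eq] at this
      refine ContinuousAt.continuousWithinAt (ContinuousAt.zpow₀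
        (continuous_pt.continuousAt.sub continuousAt_const) _ (Or.inl ?_))
      exact pt_sub_ne_zero (by rintro rfl; exact hz' hp)
  have hφ0 : ∀ z, φ z ≠ 0 := by
    intro z
    by_cases hz : z ∈ U
    · simp only [φ, if_pos hz]
      exact div_ne_zero (Complex.exp_ne_zero _) (hh0 z (subset_closure hz))
    · simp only [φ, if_neg hz]
      exact zpow_ne_zero _ (pt_sub_ne_zero (by rintro rfl; exact hz hp))
  obtain ⟨r, hr⟩ : ∃ r : ℝ, ∀ z ∈ U, ‖pt z - pt p‖ ≤ r := by
    have h1 : IsCompact (closure U) := hb.isCompact_closure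
    obtain ⟨r, hr⟩ := h1.exists_bound_of_continuousOn (f := fun z => pt z - pt p)
      (by have := continuous_pt; fun_prop)
    exact ⟨r, fun z hz => hr z (subset_closure hz)⟩
  have hr0 : 0 ≤ r := (norm_nonneg _).trans (hr p hp)
  refine not_hasLog_circle (p := p) (r := r + 1) (by linarith) hc
    (((hasLog_univ hφ hφ0).mono (subset_univ _)).congr fun z hz => ?_)
  have hzU : z ∉ U := fun hzU => by
    have := hr z hzU
    have hz' : ‖pt z - pt p‖ = r + 1 := hz
    linarith
  simp only [φ, if_neg hzU]

section Faces

variable {K L U W S : Set (ℝ × ℝ)} {p q : ℝ × ℝ}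

lemma subset_of_frontier (hS : IsPreconnected S) (hU : (S ∩ U).Nonempty) (hSK : Disjoint S K)
    (hf : frontier U ⊆ K) : S ⊆ U := by
  intro z hz
  by_contra hzU
  have hfr : ∀ w ∈ S, w ∉ frontier U := fun w hw hwf => disjoint_left.1 hSK hw (hf hwf)
  obtain ⟨w, hw, h1, h2⟩ := hS (interior U) (closure U)ᶜ isOpen_interior isClosed_closure.isOpen_compl
    (fun w hw => by
      by_cases h : w ∈ interior U
      · exact Or.inl h
      · exact Or.inr fun hc => hfr w hw ⟨hc, h⟩)
    (by
      obtain ⟨w, hw, hwU⟩ := hU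
      exact ⟨w, hw, by_contra fun h => hfr w hw ⟨subset_closure hwU, h⟩⟩)
    ⟨z, hz, fun hc => hfr z hz ⟨hc, fun h => hzU (interior_subset h)⟩⟩
  exact h2 (subset_closure (interior_subset h1))

lemma isFaceOf_iff (hK : IsClosed K) : IsFaceOf K U ↔
    U.Nonempty ∧ IsOpen U ∧ IsPreconnected U ∧ Disjoint U K ∧ frontier U ⊆ K := by
  constructor
  · rintro ⟨z, hz, rfl⟩
    have ho : ∀ w, IsOpen (connectedComponentIn Kᶜ w) :=
      fun w => hK.isOpen_compl.connectedComponentIn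
    refine ⟨⟨z, mem_connectedComponentIn hz⟩, ho z, isPreconnected_connectedComponentIn,
      ?_, ?_⟩
    · exact disjoint_left.2 fun w hw => connectedComponentIn_subset _ _ hw
    · intro w hw
      by_contra hwK
      obtain ⟨y, hy, hy'⟩ := mem_closure_iff.1 hw.1 _ (ho w) (mem_connectedComponentIn hwK)
      have : w ∈ connectedComponentIn Kᶜ z := by
        rw [connectedComponentIn_eq hy', ← connectedComponentIn_eq hy]
        exact mem_connectedComponentIn hwK
      exact hw.2 (by rwa [(ho z).interior_eq])
  · rintro ⟨⟨z, hz⟩, ho, hc, hd, hf⟩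
    have hzK : z ∉ K := disjoint_left.1 hd hz
    refine ⟨z, hzK, Subset.antisymm
      (hc.subset_connectedComponentIn hz fun w hw => disjoint_left.1 hd hw) ?_⟩
    exact subset_of_frontier isPreconnected_connectedComponentIn
      ⟨z, mem_connectedComponentIn hzK, hz⟩
      (disjoint_left.2 fun w hw => connectedComponentIn_subset _ _ hw) hf

lemma IsFaceOf.eq_or_disjoint (hU : IsFaceOf K U) (hW : IsFaceOf K W) : U = W ∨ Disjoint U W := by
  obtain ⟨z, hz, rfl⟩ := hU
  obtain ⟨w, hw, rfl⟩ := hW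
  by_cases h : Disjoint (connectedComponentIn Kᶜ z) (connectedComponentIn Kᶜ w)
  · exact Or.inr h
  · obtain ⟨y, hy, hy'⟩ := not_disjoint_iff.1 h
    exact Or.inl ((connectedComponentIn_eq hy).trans (connectedComponentIn_eq hy').symm)

lemma IsFaceOf.closure_subset (hK : IsClosed K) (hU : IsFaceOf K U) : closure U ⊆ U ∪ K := by
  obtain ⟨-, ho, -, -, hf⟩ := (isFaceOf_iff hK).1 hU
  rw [closure_eq_self_union_frontier]
  exact union_subset_union_right _ hf

lemma exists_face (hp : p ∉ K) : ∃ U, IsFaceOf K U ∧ p ∈ U :=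
  ⟨_, ⟨p, hp, rfl⟩, mem_connectedComponentIn hp⟩

/-- Points in the same face of a closed set `K` give a logarithm on `K`. -/
lemma IsFaceOf.hasLog (hK : IsClosed K) (hU : IsFaceOf K U) (hp : p ∈ U) (hq : q ∈ U) :
    HasLog K (fun z => (pt z - pt p) * (pt z - pt q)⁻¹) := by
  obtain ⟨-, ho, hc, hd, hf⟩ := (isFaceOf_iff hK).1 hU
  have hne : ∀ r ∈ U, ∀ z ∈ K, pt z - pt r ≠ 0 := fun r hr z hz =>
    pt_sub_ne_zero (by rintro rfl; exact disjoint_left.1 hd hr hz)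
  have loc : ∀ r ∈ U, ∃ N, IsOpen N ∧ r ∈ N ∧ ∀ r' ∈ N,
      r' ∈ U ∧ HasLog K (fun z => (pt z - pt r) * (pt z - pt r')⁻¹) := by
    intro r hr
    have h1 : IsOpen (pt '' U) := pt.isOpenMap _ ho
    obtain ⟨ε, hε, hball⟩ := Metric.isOpen_iff.1 h1 (pt r) ⟨r, hr, rfl⟩
    refine ⟨{r' | ‖pt r' - pt r‖ < ε / 2},
      isOpen_lt (by have := continuous_pt; fun_prop) continuous_const,
      by simpa using hε, fun r' hr' => ?_⟩
    have hr'' : ‖pt r' - pt r‖ < ε / 2 := hr'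
    have hr'U : r' ∈ U := by
      obtain ⟨y, hy, hy'⟩ := hball (a := pt r') (by rw [Metric.mem_ball, dist_eq_norm]; linarith)
      rwa [← pt.injective hy']
    refine ⟨hr'U, hasLog_of_mem_slitPlane ?_ ?_⟩
    · have := continuous_pt
      exact ContinuousOn.mul (by fun_prop)
        (ContinuousOn.inv₀ (by fun_prop) fun z hz => hne r' hr'U z hz)
    · intro z hz
      have hz1 : ε ≤ ‖pt z - pt r‖ := by
        by_contra hlt
        obtain ⟨y, hy, hy'⟩ := hball (a := pt z)
          (by rw [Metric.mem_ball, dist_eq_norm]; linarith)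
        rw [pt.injective hy'] at hy
        exact disjoint_left.1 hd hy hz
      have hz2 : ε / 2 < ‖pt z - pt r'‖ := by
        have := norm_sub_le_norm_sub_add_norm_sub (pt z) (pt r') (pt r)
        linarith
      have hne' := hne r' hr'U z hz
      have hlt : ‖(pt z - pt r) * (pt z - pt r')⁻¹ - 1‖ < 1 := by
        have : (pt z - pt r) * (pt z - pt r')⁻¹ - 1 = (pt r' - pt r) * (pt z - pt r')⁻¹ := by
          field_simp; ring
        rw [this, norm_mul, norm_inv, ← div_eq_mul_inv, div_lt_one (by linarith)]
        linarith
      have := Complex.mem_slitPlane_of_norm_lt_one hlt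
      simpa using this
  by_contra hno
  let A := {r | r ∈ U ∧ HasLog K (fun z => (pt z - pt p) * (pt z - pt r)⁻¹)}
  let B := {r | r ∈ U ∧ ¬ HasLog K (fun z => (pt z - pt p) * (pt z - pt r)⁻¹)}
  have trans : ∀ r ∈ U, ∀ r' ∈ U, ∀ s ∈ U, HasLog K (fun z => (pt z - pt r) * (pt z - pt r')⁻¹) →
      HasLog K (fun z => (pt z - pt r') * (pt z - pt s)⁻¹) →
      HasLog K (fun z => (pt z - pt r) * (pt z - pt s)⁻¹) := by
    intro r hr r' hr' s hs h h'
    refine (h.mul h').congr fun z hz => ?_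
    have := hne r' hr' z hz
    field_simp
  have symm : ∀ r ∈ U, ∀ r' ∈ U, HasLog K (fun z => (pt z - pt r) * (pt z - pt r')⁻¹) →
      HasLog K (fun z => (pt z - pt r') * (pt z - pt r)⁻¹) := by
    intro r hr r' hr' h
    refine h.inv.congr fun z hz => ?_
    rw [mul_inv, inv_inv, mul_comm]
  have hA : IsOpen A := isOpen_iff_mem_nhds.2 fun r ⟨hr, h⟩ => by
    obtain ⟨N, hN, hrN, h'⟩ := loc r hr
    exact Filter.mem_of_superset (hN.mem_nhds hrN) fun r' hr' =>
      ⟨(h' r' hr').1, trans p hp r hr r' (h' r' hr').1 h (h' r' hr').2⟩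
  have hB : IsOpen B := isOpen_iff_mem_nhds.2 fun r ⟨hr, h⟩ => by
    obtain ⟨N, hN, hrN, h'⟩ := loc r hr
    exact Filter.mem_of_superset (hN.mem_nhds hrN) fun r' hr' =>
      ⟨(h' r' hr').1, fun hl => h (trans p hp r' (h' r' hr').1 r hr hl
        (symm r hr r' (h' r' hr').1 (h' r' hr').2))⟩
  have hpA : p ∈ A := ⟨hp, ⟨fun _ => 0, continuousOn_const, fun z hz => by
    simp only [mul_inv_cancel₀ (hne p hp z hz), Complex.exp_zero]⟩⟩
  obtain ⟨y, -, hy, hy'⟩ := hc A B hA hB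
    (fun r hr => by by_cases h : HasLog K (fun z => (pt z - pt p) * (pt z - pt r)⁻¹)
                    · exact Or.inl ⟨hr, h⟩
                    · exact Or.inr ⟨hr, h⟩) ⟨p, hp, hpA⟩ ⟨q, hq, hq, hno⟩
  exact hy'.2 hy.2

lemma isPreconnected_exterior (r : ℝ) : IsPreconnected {z : ℝ × ℝ | max r 0 < ‖pt z‖} := by
  have h : {z : ℝ × ℝ | max r 0 < ‖pt z‖} =
      (fun x : ℝ × ℝ => circ (pt.symm 0) x.1 x.2) '' (Ioi (max r 0) ×ˢ univ) := by
    ext z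
    simp only [mem_ofPred_eq, mem_image, mem_prod, mem_Ioi, mem_univ, and_true, Prod.exists]
    constructor
    · intro hz
      refine ⟨‖pt z‖, (pt z).arg, hz, ?_⟩
      rw [circ, pt.apply_symm_apply, zero_add, Complex.norm_mul_exp_arg_mul_I, pt.symm_apply_apply]
    · rintro ⟨s, t, hs, rfl⟩
      have := norm_pt_circ (pt.symm 0) ((le_max_right r 0).trans hs.le) t
      rw [pt.apply_symm_apply, sub_zero] at this
      rwa [this]
  rw [h]
  exact (isPreconnected_Ioi.prod isPreconnected_univ).image _ (continuous_circ _).continuousOn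

/-- A bounded set has at most one unbounded face. -/
lemma IsFaceOf.bounded_or_bounded (hK : IsCompact K) (hU : IsFaceOf K U) (hW : IsFaceOf K W)
    (hne : U ≠ W) : Bornology.IsBounded U ∨ Bornology.IsBounded W := by
  obtain ⟨r, hr⟩ := hK.exists_bound_of_continuousOn continuous_pt.continuousOn
  have hbd : ∀ X, IsFaceOf K X → ¬ Bornology.IsBounded X →
      {z : ℝ × ℝ | max r 0 < ‖pt z‖} ⊆ X := by
    intro X hX hnb
    obtain ⟨-, ho, -, -, hf⟩ := (isFaceOf_iff hK.isClosed).1 hX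
    refine subset_of_frontier (K := K) (isPreconnected_exterior r) ?_ ?_ hf
    · by_contra hemp
      apply hnb
      have hb : Bornology.IsBounded (pt.symm '' Metric.closedBall 0 (max r 0)) :=
        ((isCompact_closedBall _ _).image pt.symm.continuous).isBounded
      refine hb.subset fun z hz => ⟨pt z, ?_, pt.symm_apply_apply z⟩
      rw [mem_closedBall_zero_iff]
      by_contra hlt
      exact hemp ⟨z, not_le.1 hlt, hz⟩
    · exact disjoint_left.2 fun z hz hzK => not_lt.2 ((hr z hzK).trans (le_max_left r 0)) hz
  by_contra h
  push Not at h
  rcases IsFaceOf.eq_or_disjoint hU hW with h' | h'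
  · exact hne h'
  · have h1 := hbd U hU h.1
    have h2 := hbd W hW h.2
    have hz : circ (pt.symm 0) (max r 0 + 1) 0 ∈ {z : ℝ × ℝ | max r 0 < ‖pt z‖} := by
      have := norm_pt_circ (pt.symm 0) (add_nonneg (le_max_right r 0) zero_le_one) 0
      rw [pt.apply_symm_apply, sub_zero] at this
      simp only [mem_ofPred_eq, this]
      linarith
    exact disjoint_left.1 h' (h1 hz) (h2 hz)

/-- Points in distinct faces of `K` give no logarithm on `K`. -/
lemma not_hasLog_of_faces_ne (hK : IsCompact K) (hU : IsFaceOf K U) (hW : IsFaceOf K W)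
    (hne : U ≠ W) (hp : p ∈ U) (hq : q ∈ W) :
    ¬ HasLog K (fun z => (pt z - pt p) * (pt z - pt q)⁻¹) := by
  have key : ∀ U W p q, IsFaceOf K U → IsFaceOf K W → U ≠ W → p ∈ U → q ∈ W →
      Bornology.IsBounded U → ¬ HasLog K (fun z => (pt z - pt p) * (pt z - pt q)⁻¹) := by
    intro U W p q hU hW hne hp hq hb
    obtain ⟨-, ho, -, -, hf⟩ := (isFaceOf_iff hK.isClosed).1 hU
    obtain ⟨-, -, -, hd, -⟩ := (isFaceOf_iff hK.isClosed).1 hW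
    have hq' : ∀ z ∈ closure U, pt z - pt q ≠ 0 := fun z hz => pt_sub_ne_zero (by
      rintro rfl
      rcases IsFaceOf.closure_subset hK.isClosed hU hz with h | h
      · exact disjoint_left.1 ((IsFaceOf.eq_or_disjoint hU hW).resolve_left hne) h hq
      · exact disjoint_left.1 hd hq h)
    have := not_hasLog_of_bounded (c := 1) one_ne_zero hK.isClosed ho hb hf hp
      (h := fun z => (pt z - pt q)⁻¹)
      (ContinuousOn.inv₀ (by have := continuous_pt; fun_prop) hq')
      (fun z hz => inv_ne_zero (hq' z hz))
    simpa using this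
  rcases IsFaceOf.bounded_or_bounded hK hU hW hne with h | h
  · exact key U W p q hU hW hne hp hq h
  · refine fun hl => key W U q p hW hU hne.symm hq hp h (hl.inv.congr fun z _ => ?_)
    rw [mul_inv, inv_inv, mul_comm]

/-- Janiszewski's theorem. -/
theorem janiszewski (hK : IsCompact K) (hL : IsCompact L) (hc : IsPreconnected (K ∩ L))
    {U₁ U₂ W₁ W₂ : Set (ℝ × ℝ)} (hU₁ : IsFaceOf K U₁) (hp₁ : p ∈ U₁) (hq₁ : q ∈ U₁)
    (hU₂ : IsFaceOf L U₂) (hp₂ : p ∈ U₂) (hq₂ : q ∈ U₂)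
    (hW₁ : IsFaceOf (K ∪ L) W₁) (hp : p ∈ W₁) (hW₂ : IsFaceOf (K ∪ L) W₂) (hq : q ∈ W₂) :
    W₁ = W₂ := by
  by_contra hne
  exact not_hasLog_of_faces_ne (hK.union hL) hW₁ hW₂ hne hp hq
    (HasLog.union (Or.inl ⟨hK.isClosed, hL.isClosed⟩) hc
      (IsFaceOf.hasLog hK.isClosed hU₁ hp₁ hq₁) (IsFaceOf.hasLog hL.isClosed hU₂ hp₂ hq₂))

end Faces

/-- `P` is a simple arc from `a` to `b`. -/
def IsArc (P : Set (ℝ × ℝ)) (a b : ℝ × ℝ) : Prop :=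
  ∃ γ : ℝ → ℝ × ℝ, ContinuousOn γ (Icc 0 1) ∧ InjOn γ (Icc 0 1) ∧
    γ 0 = a ∧ γ 1 = b ∧ γ '' Icc 0 1 = P

section Arcs

variable {P Q V : Set (ℝ × ℝ)} {a b c x : ℝ × ℝ}

lemma isArc_image {γ : ℝ → ℝ × ℝ} {u v : ℝ} (h : u < v) (hc : ContinuousOn γ (Icc u v))
    (hi : InjOn γ (Icc u v)) : IsArc (γ '' Icc u v) (γ u) (γ v) := by
  have hvu : 0 < v - u := sub_pos.2 h
  have himg : (fun t => u + t * (v - u)) '' Icc 0 1 = Icc u v := by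
    ext s
    constructor
    · rintro ⟨t, ⟨h0, h1⟩, rfl⟩
      constructor <;> simp only <;> nlinarith
    · rintro ⟨h0, h1⟩
      refine ⟨(s - u) / (v - u), ⟨div_nonneg (by linarith) hvu.le, ?_⟩, ?_⟩
      · rw [div_le_one hvu]; linarith
      · simp only; field_simp; ring
  have hmaps : MapsTo (fun t => u + t * (v - u)) (Icc 0 1) (Icc u v) := by
    rw [mapsTo_iff_image_subset, himg]
  refine ⟨fun t => γ (u + t * (v - u)), hc.comp (by fun_prop) hmaps,
    hi.comp (fun s _ t _ hst => ?_) hmaps, by simp, by simp, ?_⟩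
  · have : s * (v - u) = t * (v - u) := by simpa using hst
    exact mul_right_cancel₀ hvu.ne' this
  · rw [← himg, image_image]

lemma IsArc.isCompact (h : IsArc P a b) : IsCompact P := by
  obtain ⟨γ, hc, -, -, -, rfl⟩ := h
  exact isCompact_Icc.image_of_continuousOn hc

lemma IsArc.isClosed (h : IsArc P a b) : IsClosed P := h.isCompact.isClosed

lemma IsArc.isPreconnected (h : IsArc P a b) : IsPreconnected P := by
  obtain ⟨γ, hc, -, -, -, rfl⟩ := h
  exact isPreconnected_Icc.image _ hc

lemma IsArc.left_mem (h : IsArc P a b) : a ∈ P := by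
  obtain ⟨γ, -, -, rfl, -, rfl⟩ := h
  exact ⟨0, by simp, rfl⟩

lemma IsArc.right_mem (h : IsArc P a b) : b ∈ P := by
  obtain ⟨γ, -, -, -, rfl, rfl⟩ := h
  exact ⟨1, by simp, rfl⟩

lemma IsArc.ne (h : IsArc P a b) : a ≠ b := by
  obtain ⟨γ, -, hi, rfl, rfl, -⟩ := h
  exact fun e => zero_ne_one (hi (by simp) (by simp) e)

lemma IsArc.symm (h : IsArc P a b) : IsArc P b a := by
  obtain ⟨γ, hc, hi, rfl, rfl, rfl⟩ := h
  have himg : (fun t : ℝ => 1 - t) '' Icc 0 1 = Icc 0 1 := by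
    simp [image_const_sub_Icc]
  have hmaps : MapsTo (fun t : ℝ => 1 - t) (Icc 0 1) (Icc 0 1) := by
    rw [mapsTo_iff_image_subset, himg]
  refine ⟨fun t => γ (1 - t), hc.comp (by fun_prop) hmaps,
    hi.comp (fun s _ t _ hst => by simpa using hst) hmaps, by simp, by simp, ?_⟩
  conv_rhs => rw [← himg, image_image]

lemma IsArc.trans (h : IsArc P a b) (h' : IsArc Q b c) (hPQ : P ∩ Q ⊆ {b}) : IsArc (P ∪ Q) a c := by
  obtain ⟨γ, hc, hi, rfl, hγ1, rfl⟩ := h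
  obtain ⟨δ, hc', hi', hδ0, rfl, rfl⟩ := h'
  let η : ℝ → ℝ × ℝ := fun t => if t ≤ 1 then γ t else δ (t - 1)
  have e1 : ∀ t ∈ Icc (0 : ℝ) 1, η t = γ t := fun t ht => if_pos ht.2
  have e2 : ∀ t ∈ Icc (1 : ℝ) 2, η t = δ (t - 1) := by
    intro t ht
    rcases ht.1.eq_or_lt with rfl | h
    · simp [η, hγ1, hδ0]
    · exact if_neg (not_le.2 h)
  have hm : MapsTo (fun t : ℝ => t - 1) (Icc 1 2) (Icc 0 1) := fun t ht =>
    ⟨by linarith [ht.1], by linarith [ht.2]⟩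
  have hu : Icc (0 : ℝ) 1 ∪ Icc 1 2 = Icc 0 2 := Icc_union_Icc_eq_Icc (by norm_num) (by norm_num)
  have hcη : ContinuousOn η (Icc 0 2) := by
    rw [← hu]
    exact (hc.congr e1).union_of_isClosed ((hc'.comp (by fun_prop) hm).congr e2)
      isClosed_Icc isClosed_Icc
  have i1 : InjOn η (Icc 0 1) := fun s hs t ht hst => hi hs ht (by rwa [← e1 s hs, ← e1 t ht])
  have i2 : InjOn η (Icc 1 2) := fun s hs t ht hst => by
    have := hi' (hm hs) (hm ht) (by rwa [e2 s hs, e2 t ht] at hst)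
    simpa using this
  have i12 : ∀ s ∈ Icc (0 : ℝ) 1, ∀ t ∈ Icc (1 : ℝ) 2, η s = η t → s = t := by
    intro s hs t ht hst
    rw [e1 s hs, e2 t ht] at hst
    have hb : γ s = b := hPQ ⟨⟨s, hs, rfl⟩, ⟨t - 1, hm ht, hst.symm⟩⟩
    have h1 : s = 1 := hi hs (by simp) (hb.trans hγ1.symm)
    have h2 : t - 1 = 0 := hi' (hm ht) (by simp) (hst.symm.trans (hb.trans hδ0.symm))
    linarith
  have hiη : InjOn η (Icc 0 2) := by
    rw [← hu]
    rintro s (hs | hs) t (ht | ht) hst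
    · exact i1 hs ht hst
    · exact i12 s hs t ht hst
    · exact (i12 t ht s hs hst.symm).symm
    · exact i2 hs ht hst
  have himg2 : (fun t : ℝ => t - 1) '' Icc 1 2 = Icc 0 1 := by
    rw [image_sub_const_Icc]; norm_num
  have key := isArc_image (by norm_num : (0 : ℝ) < 2) hcη hiη
  rw [e1 0 (by simp), e2 2 (by simp), ← hu, image_union, image_congr e1, image_congr e2,
    ← image_image δ, himg2] at key
  convert key using 2
  norm_num

lemma IsArc.split (h : IsArc P a b) (hx : x ∈ P) (ha : x ≠ a) (hb : x ≠ b) :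
    ∃ P₁ P₂, IsArc P₁ a x ∧ IsArc P₂ x b ∧ P₁ ∩ P₂ = {x} ∧ P₁ ∪ P₂ = P := by
  obtain ⟨γ, hc, hi, rfl, rfl, rfl⟩ := h
  obtain ⟨s, hs, rfl⟩ := hx
  have h0 : 0 < s := lt_of_le_of_ne hs.1 (by rintro rfl; exact ha rfl)
  have h1 : s < 1 := lt_of_le_of_ne hs.2 (by rintro rfl; exact hb rfl)
  have s1 : Icc 0 s ⊆ Icc (0 : ℝ) 1 := Icc_subset_Icc_right h1.le
  have s2 : Icc s 1 ⊆ Icc (0 : ℝ) 1 := Icc_subset_Icc_left h0.le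
  refine ⟨_, _, isArc_image h0 (hc.mono s1) (hi.mono s1), isArc_image h1 (hc.mono s2) (hi.mono s2),
    ?_, ?_⟩
  · rw [← hi.image_inter s1 s2, Icc_inter_Icc_eq_singleton h0.le h1.le, image_singleton]
  · rw [← image_union, Icc_union_Icc_eq_Icc h0.le h1.le]

/-- The interior of an arc is nonempty, connected and dense in the arc. -/
lemma IsArc.interior (h : IsArc P a b) :
    (P \ {a, b}).Nonempty ∧ IsPreconnected (P \ {a, b}) ∧ P ⊆ closure (P \ {a, b}) := by
  obtain ⟨γ, hc, hi, rfl, rfl, rfl⟩ := h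
  have hsub : Ioo (0 : ℝ) 1 ⊆ Icc 0 1 := Ioo_subset_Icc_self
  have e : γ '' Icc 0 1 \ {γ 0, γ 1} = γ '' Ioo 0 1 := by
    rw [← image_pair, ← hi.image_sdiff_subset (by intro t; rintro (rfl | rfl) <;> simp),
      Icc_sdiff_both]
  rw [e]
  refine ⟨⟨γ (1 / 2), _, ⟨by norm_num, by norm_num⟩, rfl⟩, isPreconnected_Ioo.image _ (hc.mono hsub),
    ?_⟩
  have : Icc (0 : ℝ) 1 = closure (Ioo 0 1) := (closure_Ioo zero_ne_one).symm
  conv_lhs => rw [this]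
  exact ContinuousOn.image_closure (by rwa [← this])

lemma IsArc.isPreconnected_sdiff_left (h : IsArc P a b) : IsPreconnected (P \ {a}) := by
  obtain ⟨-, h1, h2⟩ := h.interior
  refine h1.subset_closure (fun z hz => ⟨hz.1, fun e => hz.2 (Or.inl e)⟩)
    (sdiff_subset.trans h2)

/-- Cutting off a small initial segment of an arc. -/
lemma IsArc.shrink (h : IsArc P a b) (hV : V ∈ 𝓝 a) :
    ∃ P' c, IsArc P' c b ∧ P' ⊆ P ∧ P \ V ⊆ P' ∧ a ∉ P' := by
  obtain ⟨γ, hc, hi, rfl, rfl, rfl⟩ := h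
  have h0 : (0 : ℝ) ∈ Icc (0 : ℝ) 1 := by simp
  obtain ⟨ε, hε, hball⟩ := Metric.mem_nhdsWithin_iff.1 (hc 0 h0 hV)
  let s := min (ε / 2) (1 / 2)
  have hs0 : 0 < s := lt_min (by linarith) (by norm_num)
  have hs1 : s < 1 := (min_le_right _ _).trans_lt (by norm_num)
  have hsε : s < ε := (min_le_left _ _).trans_lt (by linarith)
  have s2 : Icc s 1 ⊆ Icc (0 : ℝ) 1 := Icc_subset_Icc_left hs0.le
  refine ⟨_, _, isArc_image hs1 (hc.mono s2) (hi.mono s2), image_mono s2, ?_, ?_⟩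
  · rintro _ ⟨⟨t, ht, rfl⟩, htV⟩
    refine ⟨t, ⟨?_, ht.2⟩, rfl⟩
    by_contra hlt
    refine htV (hball ⟨?_, ht⟩)
    rw [Metric.mem_ball, Real.dist_0_eq_abs, abs_of_nonneg ht.1]
    linarith [not_le.1 hlt]
  · rintro ⟨t, ht, e⟩
    have := hi (s2 ht) h0 e
    linarith [ht.1]

/-- Every nonvanishing function on an arc has a logarithm. -/
lemma IsArc.hasLog (h : IsArc P a b) {f : ℝ × ℝ → ℂ} (hf : ContinuousOn f P)
    (h0 : ∀ z ∈ P, f z ≠ 0) : HasLog P f := by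
  obtain ⟨γ, hc, hi, rfl, rfl, rfl⟩ := h
  have hm : ∀ t, γ (projIcc (0 : ℝ) 1 zero_le_one t) ∈ γ '' Icc 0 1 :=
    fun t => ⟨_, (projIcc (0 : ℝ) 1 zero_le_one t).2, rfl⟩
  have hcγ : Continuous fun t => γ (projIcc (0 : ℝ) 1 zero_le_one t) :=
    hc.domRestrict.comp continuous_projIcc
  obtain ⟨g, hg, e⟩ := hasLog_univ (f := fun t => f (γ (projIcc (0 : ℝ) 1 zero_le_one t)))
    (hf.comp_continuous hcγ hm) (fun t => h0 _ (hm t))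
  let γ' : Icc (0 : ℝ) 1 → ℝ × ℝ := (Icc (0 : ℝ) 1).domRestrict γ
  have hemb : IsClosedEmbedding γ' :=
    hc.domRestrict.isClosedEmbedding (injOn_iff_injective.1 hi)
  have hr : range γ' = γ '' Icc 0 1 := range_domRestrict _ _
  let ψ : ℝ × ℝ → ℂ := fun z => g (Function.invFunOn γ (Icc 0 1) z)
  refine ⟨ψ, ?_, ?_⟩
  · rw [continuousOn_iff_continuous_domRestrict, ← hr]
    rw [← hemb.isEmbedding.toHomeomorph.comp_continuous_iff']
    have : (range γ').domRestrict ψ ∘ hemb.isEmbedding.toHomeomorph =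
        fun t : Icc (0 : ℝ) 1 => g (t : ℝ) := by
      funext t
      change g (Function.invFunOn γ (Icc 0 1) (γ t)) = g t
      rw [hi.leftInvOn_invFunOn t.2]
    rw [this]
    exact (continuousOn_univ.1 hg).comp continuous_subtype_val
  · rintro _ ⟨t, ht, rfl⟩
    change Complex.exp (g (Function.invFunOn γ (Icc 0 1) (γ t))) = _
    rw [hi.leftInvOn_invFunOn ht, e t trivial]
    simp only [projIcc_of_mem _ ht]

/-- An arc does not separate the plane. -/
theorem IsArc.face_unique (h : IsArc P a b) {U W : Set (ℝ × ℝ)} (hU : IsFaceOf P U)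
    (hW : IsFaceOf P W) : U = W := by
  by_contra hne
  obtain ⟨⟨p, hp⟩, -, -, hdp, -⟩ := (isFaceOf_iff h.isClosed).1 hU
  obtain ⟨⟨q, hq⟩, -, -, hdq, -⟩ := (isFaceOf_iff h.isClosed).1 hW
  have h1 : ∀ z ∈ P, pt z - pt p ≠ 0 := fun z hz =>
    pt_sub_ne_zero (by rintro rfl; exact disjoint_left.1 hdp hp hz)
  have h2 : ∀ z ∈ P, pt z - pt q ≠ 0 := fun z hz =>
    pt_sub_ne_zero (by rintro rfl; exact disjoint_left.1 hdq hq hz)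
  have := continuous_pt
  exact not_hasLog_of_faces_ne h.isCompact hU hW hne hp hq
    (h.hasLog (ContinuousOn.mul (by fun_prop) (ContinuousOn.inv₀ (by fun_prop) h2))
      fun z hz => mul_ne_zero (h1 z hz) (inv_ne_zero (h2 z hz)))

/-- On the complement of an arc from `a` to `b`, the function `(z - b) / (z - a)` has a
logarithm. -/
lemma IsArc.hasLog_compl (h : IsArc P a b) :
    HasLog Pᶜ (fun z => (pt z - pt b) * (pt z - pt a)⁻¹) := by
  have haP := h.left_mem
  obtain ⟨γ, hc, hi, rfl, rfl, rfl⟩ := h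
  have hne : ∀ z : ↥(γ '' Icc (0 : ℝ) 1)ᶜ, ∀ t : unitInterval, pt z - pt (γ t) ≠ 0 :=
    fun z t => pt_sub_ne_zero (fun e => z.2 (e ▸ ⟨t, t.2, rfl⟩))
  have hpt := continuous_pt
  have hcγ : Continuous fun t : unitInterval => γ t := hc.domRestrict
  let H : C(unitInterval × ↥(γ '' Icc (0 : ℝ) 1)ᶜ, {w : ℂ // w ≠ 0}) :=
    ⟨fun x => ⟨(pt x.2 - pt (γ x.1)) * (pt x.2 - pt (γ (0 : unitInterval)))⁻¹,
      mul_ne_zero (hne _ _) (inv_ne_zero (hne _ _))⟩, by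
      have h2 : Continuous fun x : unitInterval × ↥(γ '' Icc (0 : ℝ) 1)ᶜ => pt x.2 :=
        hpt.comp (continuous_subtype_val.comp continuous_snd)
      refine Continuous.subtype_mk (Continuous.mul (h2.sub (hpt.comp (hcγ.comp continuous_fst)))
        (Continuous.inv₀ (h2.sub continuous_const) fun x => hne _ _)) _⟩
  have H0 : ∀ z, H (0, z) = ⟨_, Complex.exp_ne_zero ((ContinuousMap.const _ (0 : ℂ)) z)⟩ := by
    intro z
    refine Subtype.ext ?_
    simp only [H, ContinuousMap.coe_mk, ContinuousMap.const_apply, Complex.exp_zero]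
    exact mul_inv_cancel₀ (hne z 0)
  have hl := Complex.isCoveringMap_exp.liftHomotopy_lifts H (ContinuousMap.const _ (0 : ℂ)) H0
  set F := Complex.isCoveringMap_exp.liftHomotopy H (ContinuousMap.const _ (0 : ℂ)) H0
  refine ⟨fun z => if hz : z ∈ (γ '' Icc (0 : ℝ) 1)ᶜ then F (1, ⟨z, hz⟩) else 0, ?_, ?_⟩
  · rw [continuousOn_iff_continuous_domRestrict]
    have : ((γ '' Icc (0 : ℝ) 1)ᶜ).domRestrict (fun z => if hz : z ∈ (γ '' Icc (0 : ℝ) 1)ᶜ then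
        F (1, ⟨z, hz⟩) else 0) = fun z => F (1, z) := by
      funext z
      exact dif_pos z.2
    rw [this]
    fun_prop
  · intro z hz
    simp only [dif_pos hz]
    have := congrArg Subtype.val (congrFun hl (1, ⟨z, hz⟩))
    simpa [H] using this

end Arcs

/-- `J` is a simple closed curve, consisting of two arcs `A` and `B` from `a` to `b`. -/
def IsSplit (J : Set (ℝ × ℝ)) (a b : ℝ × ℝ) (A B : Set (ℝ × ℝ)) : Prop :=
  IsArc A a b ∧ IsArc B a b ∧ A ∩ B = {a, b} ∧ A ∪ B = J

/-- `J` is a simple closed curve. -/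
def IsJordan (J : Set (ℝ × ℝ)) : Prop := ∃ a b A B, IsSplit J a b A B

section Jordan

variable {J A B P U W : Set (ℝ × ℝ)} {a b x y : ℝ × ℝ}

lemma IsSplit.swap (h : IsSplit J a b A B) : IsSplit J a b B A :=
  ⟨h.2.1, h.1, by rw [inter_comm, h.2.2.1], by rw [union_comm, h.2.2.2]⟩

lemma IsSplit.symm (h : IsSplit J a b A B) : IsSplit J b a A B :=
  ⟨h.1.symm, h.2.1.symm, by rw [h.2.2.1, pair_comm], h.2.2.2⟩

lemma IsSplit.isJordan (h : IsSplit J a b A B) : IsJordan J := ⟨a, b, A, B, h⟩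

lemma IsSplit.resplit (h : IsSplit J a b A B) (hy : y ∈ J) (hya : y ≠ a) :
    ∃ A' B', IsSplit J a y A' B' := by
  wlog hyA : y ∈ A generalizing A B
  · refine this h.swap ?_
    rw [← h.2.2.2] at hy
    exact hy.resolve_left hyA
  obtain ⟨hA, hB, hAB, rfl⟩ := h
  by_cases hyb : y = b
  · exact ⟨A, B, by rw [hyb]; exact hA, by rw [hyb]; exact hB, by rw [hyb]; exact hAB, rfl⟩
  obtain ⟨P₁, P₂, h₁, h₂, hi, rfl⟩ := hA.split hyA hya hyb
  have haP : a ∉ P₂ := fun e => hya.symm (hi.subset ⟨h₁.left_mem, e⟩)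
  have hbP : b ∉ P₁ := fun e => hyb ((hi.subset ⟨e, h₂.right_mem⟩).symm)
  refine ⟨P₁, B ∪ P₂, h₁, hB.trans h₂.symm ?_, ?_, ?_⟩
  · rintro z ⟨hzB, hz⟩
    rcases hAB.subset ⟨Or.inr hz, hzB⟩ with rfl | e
    exacts [(haP hz).elim, e]
  · refine subset_antisymm ?_ ?_
    · rintro z ⟨hz, hzB | hz2⟩
      · rcases hAB.subset ⟨Or.inl hz, hzB⟩ with rfl | rfl
        exacts [Or.inl rfl, (hbP hz).elim]
      · exact Or.inr (hi.subset ⟨hz, hz2⟩)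
    · rintro z (rfl | rfl)
      exacts [⟨h₁.left_mem, Or.inl hB.left_mem⟩, ⟨h₁.right_mem, Or.inr h₂.left_mem⟩]
  · ext z
    simp only [mem_union]
    tauto

lemma IsJordan.split (h : IsJordan J) (hx : x ∈ J) (hy : y ∈ J) (hxy : x ≠ y) :
    ∃ A B, IsSplit J x y A B := by
  obtain ⟨a, b, A, B, h⟩ := h
  by_cases hxa : x = a
  · subst hxa
    exact h.resplit hy hxy.symm
  · obtain ⟨A', B', h'⟩ := h.resplit hx hxa
    exact h'.symm.resplit hy hxy.symm

lemma IsJordan.isCompact (h : IsJordan J) : IsCompact J := by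
  obtain ⟨a, b, A, B, hA, hB, -, rfl⟩ := h
  exact hA.isCompact.union hB.isCompact

lemma IsJordan.isClosed (h : IsJordan J) : IsClosed J := h.isCompact.isClosed

lemma IsSplit.not_isPreconnected_compl (h : IsSplit J a b A B) : ¬ IsPreconnected Jᶜ := by
  intro hc
  obtain ⟨hA, hB, hAB, rfl⟩ := h
  have hab : pt a - pt b ≠ 0 := pt_sub_ne_zero hA.ne
  rw [compl_union] at hc
  have hl := HasLog.union (Or.inr ⟨hA.isClosed.isOpen_compl, hB.isClosed.isOpen_compl⟩) hc
    hA.hasLog_compl hB.hasLog_compl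
  rw [← compl_inter, hAB] at hl
  have hr : 0 < ‖pt a - pt b‖ / 2 := half_pos (norm_pos_iff.2 hab)
  have hpt := continuous_pt
  set S := {z : ℝ × ℝ | ‖pt z - pt a‖ = ‖pt a - pt b‖ / 2}
  have hb0 : ∀ z ∈ S, pt z - pt b ≠ 0 := by
    intro z (hz : _ = _) e
    rw [sub_eq_zero.1 e, norm_sub_rev] at hz
    linarith
  have hsub : S ⊆ {a, b}ᶜ := by
    rintro z hz (rfl | rfl)
    · have hz' : ‖pt z - pt z‖ = ‖pt z - pt b‖ / 2 := hz
      rw [sub_self, norm_zero] at hz'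
      linarith
    · exact hb0 _ hz (sub_self _)
  have h1 : HasLog S (fun z => (pt z - pt b) * (pt a - pt b)⁻¹) := by
    refine hasLog_of_mem_slitPlane (by fun_prop) fun z hz => ?_
    have e : (pt z - pt b) * (pt a - pt b)⁻¹ = 1 + (pt z - pt a) * (pt a - pt b)⁻¹ := by
      field_simp; ring
    rw [e]
    refine Complex.mem_slitPlane_of_norm_lt_one ?_
    have hz' : ‖pt z - pt a‖ = ‖pt a - pt b‖ / 2 := hz
    rw [norm_mul, norm_inv, hz']
    field_simp
    norm_num
  have h2 : HasLog S (fun _ => pt a - pt b) :=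
    ⟨fun _ => Complex.log (pt a - pt b), continuousOn_const, fun _ _ => Complex.exp_log hab⟩
  refine not_hasLog_circle hr (by norm_num : (-1 : ℤ) ≠ 0)
    (((hl.mono hsub).mul (h1.mul h2).inv).congr fun z hz => ?_)
  have := hb0 z hz
  simp only [zpow_neg, zpow_one]
  field_simp

lemma IsJordan.exists_other_face (h : IsJordan J) (hU : IsFaceOf J U) :
    ∃ W, IsFaceOf J W ∧ W ≠ U := by
  have hJ := h.isClosed
  obtain ⟨a, b, A, B, h⟩ := h
  by_contra! hne
  obtain ⟨-, -, hc, hd, -⟩ := (isFaceOf_iff hJ).1 hU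
  refine h.not_isPreconnected_compl ?_
  convert hc
  refine subset_antisymm (fun p hp => ?_) fun p hp hpJ => disjoint_left.1 hd hp hpJ
  obtain ⟨W, hW, hpW⟩ := exists_face hp
  exact hne W hW ▸ hpW

lemma IsSplit.not_bounded_faces (h : IsSplit J a b A B) (hU : IsFaceOf J U) (hW : IsFaceOf J W)
    (hne : U ≠ W) (hUb : Bornology.IsBounded U) (hWb : Bornology.IsBounded W) : False := by
  have hJ := h.isJordan.isClosed
  obtain ⟨⟨p, hp⟩, hUo, -, hUd, hUf⟩ := (isFaceOf_iff hJ).1 hU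
  obtain ⟨⟨q, hq⟩, hWo, -, hWd, hWf⟩ := (isFaceOf_iff hJ).1 hW
  have hUW := (IsFaceOf.eq_or_disjoint hU hW).resolve_left hne
  obtain ⟨hA, hB, hAB, rfl⟩ := h
  have hpt := continuous_pt
  have main : ∀ r : ℝ × ℝ, r ∉ A ∪ B → ∃ gA gB : ℝ × ℝ → ℂ, ContinuousOn gA A ∧ ContinuousOn gB B ∧
      (∀ z ∈ A, Complex.exp (gA z) = pt z - pt r) ∧ (∀ z ∈ B, Complex.exp (gB z) = pt z - pt r) ∧
      ∃ m n : ℤ, gA a - gB a = m * (2 * Real.pi * Complex.I) ∧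
        gA b - gB b = n * (2 * Real.pi * Complex.I) := by
    intro r hr
    have h0 : ∀ z ∈ A ∪ B, pt z - pt r ≠ 0 := fun z hz =>
      pt_sub_ne_zero (by rintro rfl; exact hr hz)
    obtain ⟨gA, hgA, eA⟩ := hA.hasLog (f := fun z => pt z - pt r) (by fun_prop)
      fun z hz => h0 z (Or.inl hz)
    obtain ⟨gB, hgB, eB⟩ := hB.hasLog (f := fun z => pt z - pt r) (by fun_prop)
      fun z hz => h0 z (Or.inr hz)
    have key : ∀ z ∈ A, z ∈ B → ∃ m : ℤ, gA z - gB z = m * (2 * Real.pi * Complex.I) := by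
      intro z hz hz'
      refine Complex.exp_eq_one_iff.1 ?_
      rw [Complex.exp_sub, eA z hz, eB z hz', div_self (h0 z (Or.inl hz))]
    obtain ⟨m, hm⟩ := key a hA.left_mem hB.left_mem
    obtain ⟨n, hn⟩ := key b hA.right_mem hB.right_mem
    exact ⟨gA, gB, hgA, hgB, eA, eB, m, n, hm, hn⟩
  obtain ⟨gA, gB, hgA, hgB, eA, eB, m, n, hm, hn⟩ := main p fun e => disjoint_left.1 hUd hp e
  obtain ⟨kA, kB, hkA, hkB, fA, fB, m', n', hm', hn'⟩ := main q fun e => disjoint_left.1 hWd hq e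
  have hlog : ∀ c d : ℤ, c * (m - n) + d * (m' - n') = 0 →
      HasLog (A ∪ B) (fun z => (pt z - pt p) ^ c * (pt z - pt q) ^ d) := by
    intro c d hcd
    refine hasLog_union_of_const (g := fun z => c * gA z + d * kA z)
      (g' := fun z => c * gB z + d * kB z) (Or.inl ⟨hA.isClosed, hB.isClosed⟩)
      ((continuousOn_const.mul hgA).add (continuousOn_const.mul hkA)) (fun z hz => ?_)
      ((continuousOn_const.mul hgB).add (continuousOn_const.mul hkB)) (fun z hz => ?_)
      ⟨c * m + d * m', fun z hz => ?_⟩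
    · rw [Complex.exp_add, Complex.exp_int_mul, Complex.exp_int_mul, eA z hz, fA z hz]
    · rw [Complex.exp_add, Complex.exp_int_mul, Complex.exp_int_mul, eB z hz, fB z hz]
    · have hcd' : (c : ℂ) * (m - n) + d * (m' - n') = 0 := by exact_mod_cast hcd
      push_cast
      rcases hAB.subset hz with rfl | rfl
      · linear_combination c * hm + d * hm'
      · linear_combination c * hn + d * hn' - (2 * Real.pi * Complex.I) * hcd'
  have aux : ∀ {U : Set (ℝ × ℝ)} {q : ℝ × ℝ}, IsFaceOf (A ∪ B) U → q ∉ A ∪ B → q ∉ U →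
      ∀ z ∈ closure U, pt z - pt q ≠ 0 := by
    intro U q hU hqJ hqU z hz
    refine pt_sub_ne_zero ?_
    rintro rfl
    exact (IsFaceOf.closure_subset hJ hU hz).elim hqU hqJ
  have hqU := aux hU (fun e => disjoint_left.1 hWd hq e) (fun e => disjoint_left.1 hUW e hq)
  have hpW := aux hW (fun e => disjoint_left.1 hUd hp e) (fun e => disjoint_left.1 hUW hp e)
  by_cases h0 : m - n = 0
  · exact not_hasLog_of_bounded (c := 1) (h := fun z => (pt z - pt q) ^ (0 : ℤ)) one_ne_zero hJ hUo
      hUb hUf hp (by simp only [zpow_zero]; fun_prop) (by simp) (hlog 1 0 (by simp [h0]))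
  · refine not_hasLog_of_bounded (c := m - n) (h := fun z => (pt z - pt p) ^ (-(m' - n')))
      h0 hJ hWo hWb hWf hq ?_ (fun z hz => zpow_ne_zero _ (hpW z hz))
      ((hlog (-(m' - n')) (m - n) (by ring)).congr fun z _ => mul_comm _ _)
    exact ContinuousOn.zpow₀ (by fun_prop) _ fun z hz => Or.inl (hpW z hz)

lemma IsJordan.not_bounded_faces (h : IsJordan J) (hU : IsFaceOf J U) (hW : IsFaceOf J W)
    (hne : U ≠ W) (hUb : Bornology.IsBounded U) : ¬ Bornology.IsBounded W := by
  obtain ⟨a, b, A, B, h⟩ := h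
  exact fun hWb => h.not_bounded_faces hU hW hne hUb hWb

/-- A simple closed curve has at most two faces. -/
lemma IsJordan.eq_or_eq (h : IsJordan J) (hU : IsFaceOf J U) (hW : IsFaceOf J W) (hne : U ≠ W)
    {X : Set (ℝ × ℝ)} (hX : IsFaceOf J X) : X = U ∨ X = W := by
  by_contra! hX'
  have hc := h.isCompact
  rcases IsFaceOf.bounded_or_bounded hc hU hW hne with h1 | h1
  · rcases IsFaceOf.bounded_or_bounded hc hW hX hX'.2.symm with h2 | h2
    · exact h.not_bounded_faces hU hW hne h1 h2
    · exact h.not_bounded_faces hU hX hX'.1.symm h1 h2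
  · rcases IsFaceOf.bounded_or_bounded hc hU hX hX'.1.symm with h2 | h2
    · exact h.not_bounded_faces hU hW hne h2 h1
    · exact h.not_bounded_faces hW hX hX'.2.symm h1 h2

/-- Every face of a simple closed curve has the whole curve as its frontier. -/
lemma IsJordan.frontier_eq (h : IsJordan J) (hU : IsFaceOf J U) : frontier U = J := by
  obtain ⟨hUn, hUo, hUc, hUd, hUf⟩ := (isFaceOf_iff h.isClosed).1 hU
  refine subset_antisymm hUf fun x hx => ?_
  by_contra hxU
  obtain ⟨y, hy, hyx⟩ : ∃ y ∈ J, x ≠ y := by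
    obtain ⟨a, b, A, B, hA, hB, hAB, rfl⟩ := h
    by_cases e : x = a
    · exact ⟨b, Or.inl hA.right_mem, fun e' => hA.ne (e.symm.trans e')⟩
    · exact ⟨a, Or.inl hA.left_mem, e⟩
  obtain ⟨A, B, hA, hB, hAB, rfl⟩ := h.split hx hy hyx
  obtain ⟨A', c, hA', hA'A, hsub, hxA'⟩ :=
    hA.shrink (isClosed_frontier.isOpen_compl.mem_nhds hxU)
  have harc : IsArc (A' ∪ B) c x := by
    refine hA'.trans hB.symm ?_
    rintro z ⟨hz, hzB⟩
    rcases hAB.subset ⟨hA'A hz, hzB⟩ with rfl | e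
    exacts [(hxA' hz).elim, e]
  obtain ⟨z, hzA', hzA, hz⟩ := mem_closure_iff_nhds.1 (hA.interior.2.2 hA.left_mem) _
    (hA'.isClosed.isOpen_compl.mem_nhds hxA')
  have hzB : z ∉ B := fun e => hz (hAB.subset ⟨hzA, e⟩)
  have hU' : IsFaceOf (A' ∪ B) U := by
    refine (isFaceOf_iff harc.isClosed).2 ⟨hUn, hUo, hUc,
      hUd.mono_right (union_subset_union_left _ hA'A), fun w hw => ?_⟩
    rcases hUf hw with hwA | hwB
    · exact Or.inl (hsub ⟨hwA, fun e => e hw⟩)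
    · exact Or.inr hwB
  obtain ⟨W, hW, hzW⟩ := exists_face (K := A' ∪ B) (p := z) (by rintro (e | e); exacts [hzA' e, hzB e])
  rw [← harc.face_unique hU' hW] at hzW
  exact disjoint_left.1 hUd hzW (Or.inl hzA)

end Jordan

section Crosscut

variable {J A B P R R' : Set (ℝ × ℝ)} {a b : ℝ × ℝ}

lemma IsSplit.crosscut_split (h : IsSplit J a b A B) (hR : IsFaceOf J R) (hP : IsArc P a b)
    (hPR : P \ {a, b} ⊆ R) : IsSplit (A ∪ P) a b A P := by
  obtain ⟨-, -, -, hd, -⟩ := (isFaceOf_iff h.isJordan.isClosed).1 hR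
  refine ⟨h.1, hP, subset_antisymm ?_ ?_, rfl⟩
  · rintro z ⟨hzA, hzP⟩
    by_contra hz
    exact disjoint_left.1 hd (hPR ⟨hzP, hz⟩) (h.2.2.2 ▸ Or.inl hzA)
  · rintro z (rfl | rfl)
    exacts [⟨h.1.left_mem, hP.left_mem⟩, ⟨h.1.right_mem, hP.right_mem⟩]

lemma IsSplit.crosscut_side (h : IsSplit J a b A B) (hR : IsFaceOf J R) (hR' : IsFaceOf J R')
    (hne : R' ≠ R) (hP : IsArc P a b) (hPR : P \ {a, b} ⊆ R) :
    ∃ S W, IsFaceOf (A ∪ P) S ∧ IsFaceOf (A ∪ P) W ∧ W ≠ S ∧ R' ⊆ W ∧ S ⊆ R \ P := by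
  have hs := h.crosscut_split hR hP hPR
  have hj := h.isJordan
  have hRR' := (IsFaceOf.eq_or_disjoint hR' hR).resolve_left hne
  obtain ⟨-, -, -, hRd, -⟩ := (isFaceOf_iff hj.isClosed).1 hR
  obtain ⟨-, -, hR'c, hR'd, -⟩ := (isFaceOf_iff hj.isClosed).1 hR'
  have hf := hj.frontier_eq hR'
  obtain ⟨hA, hB, hAB, rfl⟩ := h
  have hBP : B ∩ P ⊆ {a, b} := by
    rintro z ⟨hzB, hzP⟩
    by_contra hz
    exact disjoint_left.1 hRd (hPR ⟨hzP, hz⟩) (Or.inr hzB)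
  obtain ⟨⟨x, hxB, hx⟩, hBc, -⟩ := hB.interior
  have hBd : Disjoint (B \ {a, b}) (A ∪ P) := by
    refine disjoint_left.2 ?_
    rintro z ⟨hzB, hz⟩ (hzA | hzP)
    exacts [hz (hAB.subset ⟨hzA, hzB⟩), hz (hBP ⟨hzB, hzP⟩)]
  have hPR' : Disjoint R' (A ∪ P) := by
    refine disjoint_left.2 ?_
    rintro z hz (hzA | hzP)
    · exact disjoint_left.1 hR'd hz (Or.inl hzA)
    · by_cases hzab : z ∈ ({a, b} : Set (ℝ × ℝ))
      · exact disjoint_left.1 hR'd hz (Or.inl (hAB.superset hzab).1)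
      · exact disjoint_left.1 hRR' hz (hPR ⟨hzP, hzab⟩)
  obtain ⟨W, hW, hxW⟩ := exists_face (disjoint_left.1 hBd ⟨hxB, hx⟩)
  obtain ⟨S, hS, hSW⟩ := hs.isJordan.exists_other_face hW
  obtain ⟨-, hWo, -, -, hWf⟩ := (isFaceOf_iff hs.isJordan.isClosed).1 hW
  obtain ⟨-, -, -, hSd, -⟩ := (isFaceOf_iff hs.isJordan.isClosed).1 hS
  have hBW : B \ {a, b} ⊆ W := subset_of_frontier hBc ⟨x, ⟨hxB, hx⟩, hxW⟩ hBd hWf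
  have hR'W : R' ⊆ W := by
    refine subset_of_frontier hR'c ?_ hPR' hWf
    have hx' : x ∈ closure R' := frontier_subset_closure (hf.superset (Or.inr hxB))
    obtain ⟨y, hyW, hy⟩ := mem_closure_iff.1 hx' W hWo hxW
    exact ⟨y, hy, hyW⟩
  have hd := (IsFaceOf.eq_or_disjoint hS hW).resolve_left hSW
  refine ⟨S, W, hS, hW, hSW.symm, hR'W, fun z hz => ⟨?_, fun e => disjoint_left.1 hSd hz (Or.inr e)⟩⟩
  have hzJ : z ∉ A ∪ B := by
    rintro (hzA | hzB)
    · exact disjoint_left.1 hSd hz (Or.inl hzA)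
    · refine disjoint_left.1 hd hz (hBW ⟨hzB, fun e => ?_⟩)
      exact disjoint_left.1 hSd hz (Or.inl (hAB.superset e).1)
  obtain ⟨X, hX, hzX⟩ := exists_face hzJ
  rcases hj.eq_or_eq hR hR' hne.symm hX with rfl | rfl
  exacts [hzX, (disjoint_left.1 hd hz (hR'W hzX)).elim]

/-- A crosscut of a face of a simple closed curve divides it into two faces. -/
theorem IsSplit.crosscut (h : IsSplit J a b A B) (hR : IsFaceOf J R) (hP : IsArc P a b)
    (hPR : P \ {a, b} ⊆ R) : ∃ S T, IsFaceOf (A ∪ P) S ∧ IsFaceOf (B ∪ P) T ∧ Disjoint S T ∧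
      S ∪ T = R \ P := by
  obtain ⟨R', hR', hne⟩ := h.isJordan.exists_other_face hR
  have hRR' := (IsFaceOf.eq_or_disjoint hR' hR).resolve_left hne
  have hs := (h.crosscut_split hR hP hPR).isJordan
  have ht := (h.swap.crosscut_split hR hP hPR).isJordan
  obtain ⟨S, W, hS, hW, hWS, hW', hSR⟩ := h.crosscut_side hR hR' hne hP hPR
  obtain ⟨T, X, hT, hX, hXT, hX', hTR⟩ := h.swap.crosscut_side hR hR' hne hP hPR
  obtain ⟨-, -, -, hRd, -⟩ := (isFaceOf_iff h.isJordan.isClosed).1 hR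
  obtain ⟨⟨q, hq⟩, -, -, hR'd, hR'f⟩ := (isFaceOf_iff h.isJordan.isClosed).1 hR'
  obtain ⟨hA, hB, hAB, rfl⟩ := h
  refine ⟨S, T, hS, hT, ?_, subset_antisymm (union_subset hSR hTR) fun p hp => ?_⟩
  · obtain ⟨-, -, hSc, hSd, hSf⟩ := (isFaceOf_iff hs.isClosed).1 hS
    obtain ⟨-, -, hTc, hTd, hTf⟩ := (isFaceOf_iff ht.isClosed).1 hT
    by_contra hST
    obtain ⟨z, hzS, hzT⟩ := not_disjoint_iff.1 hST
    have hST' : S ⊆ T := by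
      refine subset_of_frontier hSc ⟨z, hzS, hzT⟩ (disjoint_left.2 ?_) hTf
      rintro w hw (hwB | hwP)
      exacts [disjoint_left.1 hRd (hSR hw).1 (Or.inr hwB), (hSR hw).2 hwP]
    have hTS' : T ⊆ S := by
      refine subset_of_frontier hTc ⟨z, hzT, hzS⟩ (disjoint_left.2 ?_) hSf
      rintro w hw (hwA | hwP)
      exacts [disjoint_left.1 hRd (hTR hw).1 (Or.inl hwA), (hTR hw).2 hwP]
    obtain rfl := subset_antisymm hST' hTS'
    obtain ⟨x, hxB, hx⟩ := hB.interior.1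
    have hxS : x ∈ A ∪ P := by
      rw [← hs.frontier_eq hS, ht.frontier_eq hT]
      exact Or.inl hxB
    rcases hxS with e | e
    · exact hx (hAB.subset ⟨e, hxB⟩)
    · exact disjoint_left.1 hRd (hPR ⟨e, hx⟩) (Or.inr hxB)
  · by_contra hpST
    have hpJ : p ∉ A ∪ B := fun e => disjoint_left.1 hRd hp.1 e
    have hp1 : p ∈ W := by
      obtain ⟨Y, hY, hpY⟩ := exists_face (K := A ∪ P) (p := p)
        (by rintro (e | e); exacts [hpJ (Or.inl e), hp.2 e])
      rcases hs.eq_or_eq hS hW hWS.symm hY with rfl | rfl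
      exacts [(hpST (Or.inl hpY)).elim, hpY]
    have hp2 : p ∈ X := by
      obtain ⟨Y, hY, hpY⟩ := exists_face (K := B ∪ P) (p := p)
        (by rintro (e | e); exacts [hpJ (Or.inr e), hp.2 e])
      rcases ht.eq_or_eq hT hX hXT.symm hY with rfl | rfl
      exacts [(hpST (Or.inr hpY)).elim, hpY]
    have hi : (A ∪ P) ∩ (B ∪ P) = P := by
      rw [← inter_union_distrib_right, hAB]
      refine union_eq_right.2 ?_
      rintro z (rfl | rfl)
      exacts [hP.left_mem, hP.right_mem]
    have hpΘ : p ∉ (A ∪ P) ∪ (B ∪ P) := by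
      rintro ((e | e) | (e | e))
      exacts [hpJ (Or.inl e), hp.2 e, hpJ (Or.inr e), hp.2 e]
    have hqP : q ∉ P := by
      intro e
      by_cases hq' : q ∈ ({a, b} : Set (ℝ × ℝ))
      · exact disjoint_left.1 hR'd hq (Or.inl (hAB.superset hq').1)
      · exact disjoint_left.1 hRR' hq (hPR ⟨e, hq'⟩)
    have hqΘ : q ∉ (A ∪ P) ∪ (B ∪ P) := by
      have := disjoint_left.1 hR'd hq
      rintro ((e | e) | (e | e))
      exacts [this (Or.inl e), hqP e, this (Or.inr e), hqP e]
    obtain ⟨Y, hY, hpY⟩ := exists_face hpΘ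
    obtain ⟨Z, hZ, hqZ⟩ := exists_face hqΘ
    obtain rfl := janiszewski hs.isCompact ht.isCompact (by rw [hi]; exact hP.isPreconnected)
      hW hp1 (hW' hq) hX hp2 (hX' hq) hY hpY hZ hqZ
    obtain ⟨-, -, hYc, hYd, -⟩ := (isFaceOf_iff (hs.isClosed.union ht.isClosed)).1 hY
    refine disjoint_left.1 hRR' (subset_of_frontier hYc ⟨q, hqZ, hq⟩ (hYd.mono_right ?_) hR'f hpY) hp.1
    exact union_subset_union subset_union_left subset_union_left

end Crosscut

/-- `R` is a face of a simple closed curve, namely of its frontier. -/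
def IsRegion (R : Set (ℝ × ℝ)) : Prop := IsJordan (frontier R) ∧ IsFaceOf (frontier R) R

/-- `T` consists of three arcs from `v` through `R` to distinct points of `J`, disjoint except
at `v`. -/
def IsTripod (T : Set (ℝ × ℝ)) (v : ℝ × ℝ) (J R : Set (ℝ × ℝ)) : Prop :=
  ∃ (a : Fin 3 → ℝ × ℝ) (L : Fin 3 → Set (ℝ × ℝ)), Function.Injective a ∧
    (∀ i, a i ∈ J ∧ IsArc (L i) v (a i) ∧ L i \ {a i} ⊆ R) ∧
    (∀ i j, i ≠ j → L i ∩ L j = {v}) ∧ T = ⋃ i, L i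

section Tripod

variable {J R T : Set (ℝ × ℝ)} {v : ℝ × ℝ}

lemma IsJordan.isRegion (h : IsJordan J) (hR : IsFaceOf J R) : IsRegion R := by
  rw [IsRegion, h.frontier_eq hR]
  exact ⟨h, hR⟩

lemma IsRegion.props (h : IsRegion R) : R.Nonempty ∧ IsOpen R ∧ IsPreconnected R ∧
    Disjoint R (frontier R) := by
  obtain ⟨h1, h2, h3, h4, -⟩ := (isFaceOf_iff isClosed_frontier).1 h.2
  exact ⟨h1, h2, h3, h4⟩

/-- Three arcs from a point of a region to three distinct points of its frontier divide it into
three regions. -/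
theorem IsRegion.tripod (hR : IsRegion R) (hT : IsTripod T v (frontier R) R) :
    ∃ 𝓖 : Finset (Set (ℝ × ℝ)), 𝓖.card = 3 ∧
      (∀ g ∈ 𝓖, IsRegion g ∧ frontier g ⊆ frontier R ∪ T ∧ v ∈ frontier g) ∧
      (∀ g ∈ 𝓖, ∀ g' ∈ 𝓖, g ≠ g' → Disjoint g g' ∧ frontier g ∩ frontier g' ⊆ T) ∧
      ⋃₀ (𝓖 : Set (Set (ℝ × ℝ))) = R \ T := by
  obtain ⟨a, L, ha, hL, hLL, rfl⟩ := hT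
  obtain ⟨-, -, -, hRd⟩ := hR.props
  obtain ⟨hJ, hRf⟩ := hR
  generalize frontier R = J at *
  have hLJ : ∀ i, ∀ z ∈ L i, z ∈ J → z = a i := by
    intro i z hz hzJ
    by_contra hne
    exact disjoint_left.1 hRd ((hL i).2.2 ⟨hz, hne⟩) hzJ
  have hv : ∀ i, v ∈ L i := fun i => (hL i).2.1.left_mem
  have hal : ∀ i, a i ∈ L i := fun i => (hL i).2.1.right_mem
  have hvJ : v ∉ J := fun e => (hL 0).2.1.ne (hLJ 0 v (hv 0) e)
  have hLT : ∀ i, L i ⊆ ⋃ i, L i := subset_iUnion L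
  set P := L 0 ∪ L 1 with hPdef
  have hPT : P ⊆ ⋃ i, L i := union_subset (hLT 0) (hLT 1)
  have hP : IsArc P (a 0) (a 1) :=
    (hL 0).2.1.symm.trans (hL 1).2.1 (hLL 0 1 (by decide)).subset
  have hPR : P \ {a 0, a 1} ⊆ R := by
    rintro z ⟨hz | hz, hne⟩
    · exact (hL 0).2.2 ⟨hz, fun e => hne (Or.inl e)⟩
    · exact (hL 1).2.2 ⟨hz, fun e => hne (Or.inr e)⟩
  have h20 : a 2 ≠ a 0 := ha.ne (by decide)
  have h21 : a 2 ≠ a 1 := ha.ne (by decide)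
  have ha2P : a 2 ∉ P := by
    rintro (e | e)
    exacts [h20 (hLJ 0 _ e (hL 2).1), h21 (hLJ 1 _ e (hL 2).1)]
  have hL2P : ∀ z ∈ L 2, z ∈ P → z = v := by
    rintro z hz (e | e)
    · exact (hLL 2 0 (by decide)).subset ⟨hz, e⟩
    · exact (hLL 2 1 (by decide)).subset ⟨hz, e⟩
  obtain ⟨A, B, hs, ha2A⟩ : ∃ A B, IsSplit J (a 0) (a 1) A B ∧ a 2 ∈ A := by
    obtain ⟨A, B, hs⟩ := hJ.split (hL 0).1 (hL 1).1 (ha.ne (by decide))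
    rcases hs.2.2.2.superset (hL 2).1 with e | e
    exacts [⟨A, B, hs, e⟩, ⟨B, A, hs.swap, e⟩]
  have hAJ : A ⊆ J := hs.2.2.2 ▸ subset_union_left
  have hBJ : B ⊆ J := hs.2.2.2 ▸ subset_union_right
  have hABT : A ∩ B ⊆ P := by
    rw [hs.2.2.1]
    rintro z (rfl | rfl)
    exacts [hP.left_mem, hP.right_mem]
  have ha2B : a 2 ∉ B := fun e => ha2P (hABT ⟨ha2A, e⟩)
  obtain ⟨S, X, hS, hX, hSX, hSXu⟩ := hs.crosscut hRf hP hPR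
  have hSJ := (hs.crosscut_split hRf hP hPR).isJordan
  have hXJ := (hs.swap.crosscut_split hRf hP hPR).isJordan
  obtain ⟨-, hSo, -, hSd, hSf⟩ := (isFaceOf_iff hSJ.isClosed).1 hS
  obtain ⟨-, hXo, -, hXd, hXf⟩ := (isFaceOf_iff hXJ.isClosed).1 hX
  have hSR : S ⊆ R := fun z hz => (hSXu.subset (Or.inl hz)).1
  have hXR : X ⊆ R := fun z hz => (hSXu.subset (Or.inr hz)).1
  have hXP : Disjoint X P := hXd.mono_right subset_union_right
  obtain ⟨⟨x, hx⟩, hLc, hLcl⟩ := (hL 2).2.1.interior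
  have hLSX : L 2 \ {v, a 2} ⊆ S ∪ X := by
    rw [hSXu]
    exact fun z hz => ⟨(hL 2).2.2 ⟨hz.1, fun e => hz.2 (Or.inr e)⟩,
      fun e => hz.2 (Or.inl (hL2P z hz.1 e))⟩
  have hLS : L 2 \ {v, a 2} ⊆ S := by
    rcases hLSX hx with hxS | hxX
    · refine subset_of_frontier hLc ⟨x, hx, hxS⟩ (disjoint_left.2 ?_) hSf
      rintro z hz (e | e)
      · rcases hLSX hz with h | h
        exacts [disjoint_left.1 hRd (hSR h) (hAJ e), disjoint_left.1 hRd (hXR h) (hAJ e)]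
      · exact hz.2 (Or.inl (hL2P z hz.1 e))
    · exfalso
      have hsub : L 2 \ {v, a 2} ⊆ X := by
        refine subset_of_frontier hLc ⟨x, hx, hxX⟩ (disjoint_left.2 ?_) hXf
        rintro z hz (e | e)
        · rcases hLSX hz with h | h
          exacts [disjoint_left.1 hRd (hSR h) (hBJ e), disjoint_left.1 hRd (hXR h) (hBJ e)]
        · exact hz.2 (Or.inl (hL2P z hz.1 e))
      rcases IsFaceOf.closure_subset hXJ.isClosed hX (closure_mono hsub (hLcl (hal 2))) with e | e | e
      exacts [disjoint_left.1 hRd (hXR e) (hL 2).1, ha2B e, ha2P e]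
  have hv2 : v ≠ a 2 := (hL 2).2.1.ne
  have hvP : v ∈ P := Or.inl (hv 0)
  obtain ⟨C, D, hCD⟩ := hSJ.split (Or.inr hvP) (Or.inl ha2A) hv2
  have hC : C ⊆ A ∪ P := hCD.2.2.2 ▸ subset_union_left
  have hD : D ⊆ A ∪ P := hCD.2.2.2 ▸ subset_union_right
  obtain ⟨Y, Z, hY, hZ, hYZ, hYZu⟩ := hCD.crosscut hS (hL 2).2.1 hLS
  have hYJ := (hCD.crosscut_split hS (hL 2).2.1 hLS).isJordan
  have hZJ := (hCD.swap.crosscut_split hS (hL 2).2.1 hLS).isJordan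
  have hYS : Y ⊆ S := fun z hz => (hYZu.subset (Or.inl hz)).1
  have hZS : Z ⊆ S := fun z hz => (hYZu.subset (Or.inr hz)).1
  have hXr := hXJ.isRegion hX
  have hYr := hYJ.isRegion hY
  have hZr := hZJ.isRegion hZ
  have hXY : Disjoint X Y := hSX.symm.mono_right hYS
  have hXZ : Disjoint X Z := hSX.symm.mono_right hZS
  have hne : ∀ {U W : Set (ℝ × ℝ)}, IsRegion U → Disjoint U W → U ≠ W := by
    rintro U W hU hd rfl
    exact hU.props.1.ne_empty (disjoint_self.1 hd)
  have eX := hXJ.frontier_eq hX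
  have eY := hYJ.frontier_eq hY
  have eZ := hZJ.frontier_eq hZ
  have iXY : ∀ {C}, C ⊆ A ∪ P → (B ∪ P) ∩ (C ∪ L 2) ⊆ ⋃ i, L i := by
    rintro C hC z ⟨hz, hz' | hz'⟩
    · rcases hz with hzB | hzP
      · rcases hC hz' with e | e
        exacts [hPT (hABT ⟨e, hzB⟩), hPT e]
      · exact hPT hzP
    · exact hLT 2 hz'
  have iYZ : (C ∪ L 2) ∩ (D ∪ L 2) ⊆ ⋃ i, L i := by
    rw [← inter_union_distrib_right, hCD.2.2.1]
    rintro z ((rfl | rfl) | e)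
    exacts [hLT 2 (hv 2), hLT 2 (hal 2), hLT 2 e]
  have fsub : ∀ {C}, C ⊆ A ∪ P → C ∪ L 2 ⊆ J ∪ ⋃ i, L i := fun hC =>
    union_subset (hC.trans (union_subset_union hAJ hPT)) ((hLT 2).trans subset_union_right)
  refine ⟨{X, Y, Z}, Finset.card_eq_three.2 ⟨X, Y, Z, hne hXr hXY, hne hXr hXZ, hne hYr hYZ, rfl⟩,
    ?_, ?_, ?_⟩
  · intro g hg
    simp only [Finset.mem_insert, Finset.mem_singleton] at hg
    rcases hg with rfl | rfl | rfl
    · exact ⟨hXr, eX ▸ union_subset_union hBJ hPT, eX ▸ Or.inr hvP⟩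
    · exact ⟨hYr, eY ▸ fsub hC, eY ▸ Or.inr (hv 2)⟩
    · exact ⟨hZr, eZ ▸ fsub hD, eZ ▸ Or.inr (hv 2)⟩
  · intro g hg g' hg' hgg'
    simp only [Finset.mem_insert, Finset.mem_singleton] at hg hg'
    rcases hg with rfl | rfl | rfl <;> rcases hg' with rfl | rfl | rfl
    · exact absurd rfl hgg'
    · exact ⟨hXY, by rw [eX, eY]; exact iXY hC⟩
    · exact ⟨hXZ, by rw [eX, eZ]; exact iXY hD⟩
    · exact ⟨hXY.symm, by rw [eX, eY, inter_comm]; exact iXY hC⟩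
    · exact absurd rfl hgg'
    · exact ⟨hYZ, by rw [eY, eZ]; exact iYZ⟩
    · exact ⟨hXZ.symm, by rw [eX, eZ, inter_comm]; exact iXY hD⟩
    · exact ⟨hYZ.symm, by rw [eY, eZ, inter_comm]; exact iYZ⟩
    · exact absurd rfl hgg'
  · have hTu : ⋃ i, L i = P ∪ L 2 := by
      ext z
      simp only [mem_iUnion, Fin.exists_fin_succ, hPdef, mem_union, or_assoc]
      simp [IsEmpty.exists_iff]
    have hXL : Disjoint X (L 2) := by
      refine disjoint_left.2 fun z hz hzL => ?_
      by_cases e : z = v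
      · exact disjoint_left.1 hXP hz (e ▸ hvP)
      · by_cases e' : z = a 2
        · exact disjoint_left.1 hRd (hXR hz) (e' ▸ (hL 2).1)
        · exact disjoint_left.1 hSX (hLS ⟨hzL, by rintro (h | h); exacts [e h, e' h]⟩) hz
    rw [hTu, ← sdiff_sdiff, ← hSXu, union_sdiff_distrib, ← hYZu, hXL.sdiff_eq_left]
    ext z
    simp only [Finset.coe_insert, Finset.coe_singleton, sUnion_insert, sUnion_singleton, mem_union]
    tauto

end Tripod

section Tripods

variable {ι : Type*} {T : ι → Set (ℝ × ℝ)} {p : ι → ℝ × ℝ} {R J : Set (ℝ × ℝ)}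

lemma IsTripod.mono {T J J' R R' : Set (ℝ × ℝ)} {v : ℝ × ℝ} (hT : IsTripod T v J R) (hJ : T ∩ J ⊆ J')
    (hR : T \ J ⊆ R') (hd : Disjoint R J) : IsTripod T v J' R' := by
  obtain ⟨a, L, ha, hL, hLL, rfl⟩ := hT
  refine ⟨a, L, ha, fun i => ⟨?_, (hL i).2.1, fun z hz => ?_⟩, hLL, rfl⟩
  · exact hJ ⟨mem_iUnion.2 ⟨i, (hL i).2.1.right_mem⟩, (hL i).1⟩
  · exact hR ⟨mem_iUnion.2 ⟨i, hz.1⟩, disjoint_left.1 hd ((hL i).2.2 hz)⟩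

lemma IsTripod.props {T J R : Set (ℝ × ℝ)} {v : ℝ × ℝ} (hT : IsTripod T v J R) (hd : Disjoint R J) :
    v ∈ T \ J ∧ IsPreconnected (T \ J) ∧ T \ J ⊆ R ∧ T ⊆ closure (T \ J) ∧ IsClosed T := by
  obtain ⟨a, L, ha, hL, hLL, rfl⟩ := hT
  have h1 : ∀ i, L i \ J = L i \ {a i} := by
    intro i
    ext z
    refine and_congr_right fun hz => not_congr ⟨fun hzJ => ?_, ?_⟩
    · by_contra hne
      exact disjoint_left.1 hd ((hL i).2.2 ⟨hz, hne⟩) hzJ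
    · rintro rfl
      exact (hL i).1
  have h2 : (⋃ i, L i) \ J = ⋃ i, (L i \ {a i}) := by
    rw [iUnion_sdiff]
    exact iUnion_congr h1
  have hv : ∀ i, v ∈ L i \ {a i} := fun i => ⟨(hL i).2.1.left_mem, (hL i).2.1.ne⟩
  rw [h2]
  refine ⟨mem_iUnion.2 ⟨0, hv 0⟩, ?_, iUnion_subset fun i => (hL i).2.2, iUnion_subset fun i => ?_,
    isClosed_iUnion_of_finite fun i => (hL i).2.1.isClosed⟩
  · exact isPreconnected_iUnion ⟨v, mem_iInter.2 hv⟩ fun i => (hL i).2.1.symm.isPreconnected_sdiff_left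
  · refine (hL i).2.1.interior.2.2.trans (closure_mono fun z hz => mem_iUnion.2 ⟨i, hz.1, fun e => ?_⟩)
    exact hz.2 (Or.inr e)

/-- The regions into which a region is divided by finitely many tripods. -/
theorem IsRegion.exists_subdivision (hR : IsRegion R) (s : Finset ι)
    (hT : ∀ v ∈ s, IsTripod (T v) (p v) (frontier R) R)
    (hTT : ∀ v ∈ s, ∀ w ∈ s, v ≠ w → T v ∩ T w ⊆ frontier R) :
    ∃ 𝓕 : Finset (Set (ℝ × ℝ)), 𝓕.card = 2 * s.card + 1 ∧
      (∀ f ∈ 𝓕, IsRegion f ∧ frontier f ⊆ frontier R ∪ ⋃ v ∈ s, T v) ∧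
      (∀ f ∈ 𝓕, ∀ g ∈ 𝓕, f ≠ g → Disjoint f g) ∧
      ⋃₀ (𝓕 : Set (Set (ℝ × ℝ))) = R \ ⋃ v ∈ s, T v ∧
      (∀ v ∈ s, (𝓕.filter fun f => p v ∈ closure f).card ≤ 3) ∧
      (s.Nonempty → ∀ f ∈ 𝓕, ∃ v ∈ s, p v ∈ closure f) := by
  induction s using Finset.induction_on with
  | empty => exact ⟨{R}, by simp, by simpa using hR, by simp, by simp, by simp, by simp⟩
  | insert v s hvs ih =>
    obtain ⟨𝓕, hcard, hreg, hdis, hun, h3, hex⟩ := ih (fun w hw => hT w (Finset.mem_insert_of_mem hw))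
      fun w hw u hu => hTT w (Finset.mem_insert_of_mem hw) u (Finset.mem_insert_of_mem hu)
    have hRd := hR.props.2.2.2
    have hTv := hT v (Finset.mem_insert_self v s)
    obtain ⟨hvT, hTc, hTR, hTcl, -⟩ := hTv.props hRd
    have hsep : ∀ z ∈ T v \ frontier R, z ∈ R \ ⋃ v ∈ s, T v := by
      refine fun z hz => ⟨hTR hz, fun e => ?_⟩
      obtain ⟨w, hw, hzw⟩ := mem_iUnion₂.1 e
      refine hz.2 (hTT v (Finset.mem_insert_self v s) w (Finset.mem_insert_of_mem hw) ?_ ⟨hz.1, hzw⟩)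
      rintro rfl
      exact hvs hw
    obtain ⟨f, hf, hvf⟩ := hun.superset (hsep _ hvT)
    have hfR : ∀ g ∈ 𝓕, g ⊆ R \ ⋃ v ∈ s, T v := fun g hg => hun ▸ subset_sUnion_of_mem hg
    obtain ⟨-, hfo, -, hfd⟩ := (hreg f hf).1.props
    have hTf : T v \ frontier R ⊆ f := by
      refine subset_of_frontier hTc ⟨_, hvT, hvf⟩ (disjoint_left.2 fun z hz hz' => ?_)
        (subset_refl (frontier f))
      rcases (hreg f hf).2 hz' with e | e
      exacts [hz.2 e, (hsep z hz).2 e]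
    have hTv' : IsTripod (T v) (p v) (frontier f) f := by
      refine hTv.mono (fun z hz => ?_) hTf hRd
      rw [frontier, hfo.interior_eq]
      exact ⟨closure_mono hTf (hTcl hz.1), fun e => disjoint_left.1 hRd (hfR f hf e).1 hz.2⟩
    obtain ⟨𝓖, h𝓖card, h𝓖, h𝓖dis, h𝓖un⟩ := (hreg f hf).1.tripod hTv'
    have h𝓖f : ∀ g ∈ 𝓖, g ⊆ f \ T v := fun g hg => h𝓖un ▸ subset_sUnion_of_mem hg
    have hne : ∀ g ∈ 𝓖, g.Nonempty := fun g hg => (h𝓖 g hg).1.props.1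
    have hdis' : ∀ e ∈ 𝓕.erase f, Disjoint e f := fun e he =>
      hdis e (Finset.mem_of_mem_erase he) f hf (Finset.ne_of_mem_erase he)
    have hdis'' : ∀ e ∈ 𝓕.erase f, ∀ g ∈ 𝓖, Disjoint e g := fun e he g hg =>
      (hdis' e he).mono_right ((h𝓖f g hg).trans sdiff_subset)
    have hvcl : ∀ e ∈ 𝓕.erase f, p v ∉ closure e := fun e he hcl =>
      disjoint_left.1 ((hdis' e he).closure_left hfo) hcl hvf
    have hU : (⋃ w ∈ insert v s, T w) = T v ∪ ⋃ w ∈ s, T w := by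
      rw [Finset.set_biUnion_insert]
    refine ⟨𝓕.erase f ∪ 𝓖, ?_, ?_, ?_, ?_, ?_, ?_⟩
    · rw [Finset.card_union_of_disjoint, Finset.card_erase_of_mem hf, hcard, h𝓖card,
        Finset.card_insert_of_notMem hvs]
      · omega
      · refine Finset.disjoint_left.2 fun e he he' => ?_
        exact (hne e he').ne_empty (disjoint_self.1 (hdis'' e he e he'))
    · intro g hg
      rw [hU]
      rcases Finset.mem_union.1 hg with hg | hg
      · obtain ⟨h1, h2⟩ := hreg g (Finset.mem_of_mem_erase hg)
        exact ⟨h1, h2.trans (union_subset_union_right _ subset_union_right)⟩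
      · refine ⟨(h𝓖 g hg).1, (h𝓖 g hg).2.1.trans (union_subset ?_ ?_)⟩
        · exact (hreg f hf).2.trans (union_subset_union_right _ subset_union_right)
        · exact fun z hz => Or.inr (Or.inl hz)
    · intro g hg g' hg' hgg'
      rcases Finset.mem_union.1 hg with hg | hg <;> rcases Finset.mem_union.1 hg' with hg' | hg'
      · exact hdis g (Finset.mem_of_mem_erase hg) g' (Finset.mem_of_mem_erase hg') hgg'
      · exact hdis'' g hg g' hg'
      · exact (hdis'' g' hg' g hg).symm
      · exact (h𝓖dis g hg g' hg' hgg').1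
    · rw [hU, Finset.coe_union, sUnion_union, h𝓖un]
      ext z
      constructor
      · rintro (⟨g, hg, hz⟩ | hz)
        · have hzR := hfR g (Finset.mem_of_mem_erase hg) hz
          refine ⟨hzR.1, ?_⟩
          rintro (e | e)
          · exact disjoint_left.1 (hdis' g hg) hz (hTf ⟨e, disjoint_left.1 hRd hzR.1⟩)
          · exact hzR.2 e
        · have hzR := hfR f hf hz.1
          refine ⟨hzR.1, ?_⟩
          rintro (e | e)
          exacts [hz.2 e, hzR.2 e]
      · rintro ⟨hzR, hz⟩
        obtain ⟨g, hg, hzg⟩ := hun.superset ⟨hzR, fun e => hz (Or.inr e)⟩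
        by_cases hgf : g = f
        · exact Or.inr ⟨hgf ▸ hzg, fun e => hz (Or.inl e)⟩
        · exact Or.inl ⟨g, Finset.mem_erase.2 ⟨hgf, hg⟩, hzg⟩
    · intro w hw
      rw [Finset.filter_union]
      rcases Finset.mem_insert.1 hw with rfl | hw
      · rw [Finset.filter_eq_empty_iff.2 (fun e he => hvcl e he), Finset.empty_union]
        exact (Finset.card_filter_le _ _).trans h𝓖card.le
      · have hwv : v ≠ w := by
          rintro rfl
          exact hvs hw
        have hwT := ((hT w (Finset.mem_insert_of_mem hw)).props hRd).1
        have hwTv : p w ∉ T v := fun e => hwT.2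
          (hTT v (Finset.mem_insert_self v s) w (Finset.mem_insert_of_mem hw) hwv ⟨e, hwT.1⟩)
        have hwF : ∀ g ∈ 𝓖, p w ∈ closure g → p w ∈ frontier g ∧ p w ∈ closure f := by
          intro g hg hcl
          have hwg : p w ∈ frontier g := by
            rw [frontier, (h𝓖 g hg).1.props.2.1.interior_eq]
            exact ⟨hcl, fun e => (hfR f hf (h𝓖f g hg e).1).2 (mem_biUnion hw hwT.1)⟩
          exact ⟨hwg, closure_mono ((h𝓖f g hg).trans sdiff_subset) hcl⟩
        have h1 : (𝓖.filter fun g => p w ∈ closure g).card ≤ 1 := by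
          refine Finset.card_le_one.2 fun g hg g' hg' => ?_
          rw [Finset.mem_filter] at hg hg'
          by_contra hgg'
          exact hwTv ((h𝓖dis g hg.1 g' hg'.1 hgg').2
            ⟨(hwF g hg.1 hg.2).1, (hwF g' hg'.1 hg'.2).1⟩)
        refine (Finset.card_union_le _ _).trans (le_trans ?_ (h3 w hw))
        by_cases hwf : p w ∈ closure f
        · have hmem : f ∈ 𝓕.filter fun g => p w ∈ closure g := Finset.mem_filter.2 ⟨hf, hwf⟩
          rw [Finset.filter_erase, Finset.card_erase_of_mem hmem]
          have := Finset.card_pos.2 ⟨f, hmem⟩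
          omega
        · rw [(Finset.filter_eq_empty_iff (s := 𝓖)).2 fun g hg e => hwf (hwF g hg e).2]
          simpa using Finset.card_le_card (Finset.filter_subset_filter _ (Finset.erase_subset f 𝓕))
    · intro _ g hg
      rcases Finset.mem_union.1 hg with hg | hg
      · rcases s.eq_empty_or_nonempty with rfl | hs
        · exfalso
          have h1 : 𝓕.card ≤ 1 := by simp [hcard]
          obtain ⟨hne, hg⟩ := Finset.mem_erase.1 hg
          exact hne (Finset.card_le_one.1 h1 g hg f hf)
        · obtain ⟨w, hw, hwg⟩ := hex hs g (Finset.mem_of_mem_erase hg)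
          exact ⟨w, Finset.mem_insert_of_mem hw, hwg⟩
      · exact ⟨v, Finset.mem_insert_self v s, frontier_subset_closure (h𝓖 g hg).2.2⟩

lemma IsRegion.isFaceOf {K : Set (ℝ × ℝ)} (hR : IsRegion R) (hK : IsClosed K) (hf : frontier R ⊆ K)
    (hd : Disjoint R K) : IsFaceOf K R :=
  (isFaceOf_iff hK).2 ⟨hR.props.1, hR.props.2.1, hR.props.2.2.1, hd, hf⟩

lemma IsRegion.isClosed_tripods (hR : IsRegion R) {s : Finset ι}
    (hT : ∀ v ∈ s, IsTripod (T v) (p v) (frontier R) R) :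
    IsClosed (frontier R ∪ ⋃ v ∈ s, T v) :=
  isClosed_frontier.union
    (s.finite_toSet.isClosed_biUnion fun v hv => ((hT v hv).props hR.props.2.2.2).2.2.2.2)

/-- A simple closed curve with finitely many tripods on one side has finitely many faces. -/
theorem IsRegion.finite_faces (hR : IsRegion R) {s : Finset ι}
    (hT : ∀ v ∈ s, IsTripod (T v) (p v) (frontier R) R)
    (hTT : ∀ v ∈ s, ∀ w ∈ s, v ≠ w → T v ∩ T w ⊆ frontier R) :
    {f | IsFaceOf (frontier R ∪ ⋃ v ∈ s, T v) f}.Finite := by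
  obtain ⟨𝓕, -, hreg, -, hun, -⟩ := hR.exists_subdivision s hT hTT
  obtain ⟨W, hW, hWR⟩ := hR.1.exists_other_face hR.2
  have hRd := hR.props.2.2.2
  have hcl := hR.isClosed_tripods hT
  have hWr := hR.1.isRegion hW
  have hWd : Disjoint W (frontier R) := hR.1.frontier_eq hW ▸ hWr.props.2.2.2
  have hWR' := (IsFaceOf.eq_or_disjoint hW hR.2).resolve_left hWR
  have hWf : IsFaceOf (frontier R ∪ ⋃ v ∈ s, T v) W := by
    refine hWr.isFaceOf hcl (hR.1.frontier_eq hW ▸ subset_union_left)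
      (hWd.union_right (disjoint_left.2 fun z hz e => ?_))
    obtain ⟨v, hv, hzv⟩ := mem_iUnion₂.1 e
    exact disjoint_left.1 hWR' hz
      (((hT v hv).props hRd).2.2.1 ⟨hzv, disjoint_left.1 hWd hz⟩)
  refine (𝓕.finite_toSet.insert W).subset fun f hf => ?_
  obtain ⟨⟨z, hz⟩, -, -, hfd, -⟩ := (isFaceOf_iff hcl).1 hf
  have hzK := disjoint_left.1 hfd hz
  obtain ⟨X, hX, hzX⟩ := exists_face fun e => hzK (Or.inl e)
  rcases hR.1.eq_or_eq hR.2 hW hWR.symm hX with rfl | rfl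
  · obtain ⟨g, hg, hzg⟩ := hun.superset ⟨hzX, fun e => hzK (Or.inr e)⟩
    have hgR : g ⊆ X \ ⋃ v ∈ s, T v := hun ▸ subset_sUnion_of_mem hg
    have hgf := (hreg g hg).1.isFaceOf hcl (hreg g hg).2 (disjoint_left.2 fun w hw e =>
      e.elim (disjoint_left.1 hRd (hgR hw).1) (hgR hw).2)
    exact Or.inr (((IsFaceOf.eq_or_disjoint hf hgf).resolve_right
      (not_disjoint_iff.2 ⟨z, hz, hzg⟩)) ▸ hg)
  · exact Or.inl ((IsFaceOf.eq_or_disjoint hf hWf).resolve_right (not_disjoint_iff.2 ⟨z, hz, hzX⟩))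

/-- Among the regions into which a region is divided by `k ≥ 1` tripods, at least `k + 2` have
exactly one centre on their boundary. -/
theorem IsRegion.exists_minor (hR : IsRegion R) {s : Finset ι} (hs : s.Nonempty)
    (hT : ∀ v ∈ s, IsTripod (T v) (p v) (frontier R) R)
    (hTT : ∀ v ∈ s, ∀ w ∈ s, v ≠ w → T v ∩ T w ⊆ frontier R) :
    ∃ 𝓜 : Finset (Set (ℝ × ℝ)), s.card + 2 ≤ 𝓜.card ∧
      ∀ f ∈ 𝓜, f.Nonempty ∧ f ⊆ R ∧ IsFaceOf (frontier R ∪ ⋃ v ∈ s, T v) f ∧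
        ∃! v, v ∈ s ∧ p v ∈ closure f := by
  obtain ⟨𝓕, hcard, hreg, -, hun, h3, hex⟩ := hR.exists_subdivision s hT hTT
  have hRd := hR.props.2.2.2
  have hfR : ∀ g ∈ 𝓕, g ⊆ R \ ⋃ v ∈ s, T v := fun g hg => hun ▸ subset_sUnion_of_mem hg
  let N : Set (ℝ × ℝ) → Finset ι := fun f => s.filter fun v => p v ∈ closure f
  refine ⟨𝓕.filter fun f => (N f).card = 1, ?_, fun f hf => ?_⟩
  · have hsum : ∑ f ∈ 𝓕, (N f).card ≤ 3 * s.card := by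
      have e : ∑ f ∈ 𝓕, (N f).card = ∑ v ∈ s, (𝓕.filter fun f => p v ∈ closure f).card := by
        simp only [N, Finset.card_filter]
        exact Finset.sum_comm
      rw [e, mul_comm]
      exact Finset.sum_le_card_nsmul _ _ _ h3
    have hlow : ∑ f ∈ 𝓕, 2 ≤ ∑ f ∈ 𝓕, ((N f).card + if (N f).card = 1 then 1 else 0) := by
      refine Finset.sum_le_sum fun f hf => ?_
      obtain ⟨v, hv, hvf⟩ := hex hs f hf
      have : 0 < (N f).card := Finset.card_pos.2 ⟨v, Finset.mem_filter.2 ⟨hv, hvf⟩⟩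
      split_ifs <;> omega
    rw [Finset.sum_add_distrib, ← Finset.card_filter, Finset.sum_const, hcard, smul_eq_mul] at hlow
    omega
  · obtain ⟨hf, hN⟩ := Finset.mem_filter.1 hf
    refine ⟨(hreg f hf).1.props.1, (hfR f hf).trans sdiff_subset,
      (hreg f hf).1.isFaceOf (hR.isClosed_tripods hT) (hreg f hf).2 ?_, ?_⟩
    · refine disjoint_left.2 ?_
      rintro z hz (e | e)
      exacts [disjoint_left.1 hRd (hfR f hf hz).1 e, (hfR f hf hz).2 e]
    · obtain ⟨v, hv⟩ := Finset.card_eq_one.1 hN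
      refine ⟨v, Finset.mem_filter.1 (hv.superset (Finset.mem_singleton_self v)), fun w hw => ?_⟩
      exact Finset.mem_singleton.1 (hv.subset (Finset.mem_filter.2 hw))

end Tripods

section Embedding

variable {V : Type*} {G : SimpleGraph V} (emb : PlaneEmbedding G)

/-- The drawing of a walk. -/
def drawWalk {u v : V} (p : G.Walk u v) : Set (ℝ × ℝ) := ⋃ e ∈ p.edges, arcSet emb e

variable {emb} {u v w x y : V} {z : ℝ × ℝ}

lemma isArc_arc (h : G.Adj u v) : IsArc (emb.arc u v) (emb.pos u) (emb.pos v) :=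
  emb.arc_curve u v h

lemma exists_vertex_of_mem_arcs (h : G.Adj u v) (h' : G.Adj x y) (hne : s(u, v) ≠ s(x, y))
    (hz : z ∈ emb.arc u v) (hz' : z ∈ emb.arc x y) :
    ∃ w, emb.pos w = z ∧ (w = u ∨ w = v) ∧ (w = x ∨ w = y) := by
  obtain ⟨w, rfl⟩ := emb.arc_inter u v x y h h' hne ⟨hz, hz'⟩
  exact ⟨w, rfl, emb.arc_vertex u v h w hz, emb.arc_vertex x y h' w hz'⟩

lemma mem_drawWalk {p : G.Walk x y} :
    z ∈ drawWalk emb p ↔ ∃ u v, s(u, v) ∈ p.edges ∧ z ∈ emb.arc u v := by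
  simp only [drawWalk, mem_iUnion, exists_prop, Sym2.exists, arcSet, Sym2.lift_mk]

lemma exists_vertex_of_mem_drawWalk (h : G.Adj u v) {p : G.Walk x y} (hp : s(u, v) ∉ p.edges)
    (hz : z ∈ emb.arc u v) (hz' : z ∈ drawWalk emb p) :
    ∃ w, emb.pos w = z ∧ (w = u ∨ w = v) ∧ w ∈ p.support := by
  obtain ⟨a, b, hab, hzab⟩ := mem_drawWalk.1 hz'
  obtain ⟨w, hw, h1, h2⟩ := exists_vertex_of_mem_arcs h (p.adj_of_mem_edges hab)
    (fun e => hp (e ▸ hab)) hz hzab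
  refine ⟨w, hw, h1, ?_⟩
  rcases h2 with rfl | rfl
  exacts [p.fst_mem_support_of_mem_edges hab, p.snd_mem_support_of_mem_edges hab]

lemma drawWalk_cons (h : G.Adj u v) (p : G.Walk v w) :
    drawWalk emb (SimpleGraph.Walk.cons h p) = emb.arc u v ∪ drawWalk emb p := by
  ext z
  simp [drawWalk, arcSet]

lemma isArc_drawWalk (p : G.Walk u v) (hp : p.IsPath) (huv : u ≠ v) :
    IsArc (drawWalk emb p) (emb.pos u) (emb.pos v) := by
  induction p with
  | nil => exact absurd rfl huv
  | @cons u v w h p ih =>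
    rw [drawWalk_cons]
    obtain ⟨hp, hu⟩ := (SimpleGraph.Walk.cons_isPath_iff h p).1 hp
    by_cases hvw : v = w
    · subst hvw
      obtain rfl := (hp.nil_iff_eq.2 rfl).eq_nil
      simpa [drawWalk] using isArc_arc h
    · refine (isArc_arc h).trans (ih hp hvw) ?_
      rintro z ⟨hz, hz'⟩
      obtain ⟨a, rfl, rfl | rfl, ha⟩ := exists_vertex_of_mem_drawWalk h
        (fun e => hu (p.fst_mem_support_of_mem_edges e)) hz hz'
      exacts [(hu ha).elim, rfl]

lemma isJordan_drawWalk (C : G.Walk x x) (hC : C.IsCycle) : IsJordan (drawWalk emb C) := by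
  cases C with
  | nil => exact absurd hC SimpleGraph.Walk.not_isCycle_nil
  | @cons _ v _ h p =>
    obtain ⟨hp, he⟩ := (SimpleGraph.Walk.cons_isCycle_iff p h).1 hC
    refine ⟨_, _, _, _, (isArc_arc h).symm, isArc_drawWalk p hp h.ne.symm, ?_, (drawWalk_cons h p).symm⟩
    refine subset_antisymm ?_ ?_
    · rintro z ⟨hz, hz'⟩
      obtain ⟨a, rfl, rfl | rfl, ha⟩ := exists_vertex_of_mem_drawWalk h he hz hz'
      exacts [Or.inr rfl, Or.inl rfl]
    · have h1 := isArc_arc (emb := emb) h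
      have h2 := isArc_drawWalk (emb := emb) p hp h.ne.symm
      rintro z (rfl | rfl)
      exacts [⟨h1.right_mem, h2.left_mem⟩, ⟨h1.left_mem, h2.right_mem⟩]

lemma pos_mem_drawWalk {C : G.Walk x x} (hC : C.IsCycle) :
    emb.pos v ∈ drawWalk emb C ↔ v ∈ C.support := by
  constructor
  · intro h
    obtain ⟨a, b, hab, hv⟩ := mem_drawWalk.1 h
    rcases emb.arc_vertex a b (C.adj_of_mem_edges hab) v hv with rfl | rfl
    exacts [C.fst_mem_support_of_mem_edges hab, C.snd_mem_support_of_mem_edges hab]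
  · intro h
    obtain ⟨e, he, hve⟩ := (SimpleGraph.Walk.mem_support_iff_exists_mem_edges_of_not_nil hC.not_nil).1 h
    obtain ⟨b, rfl⟩ := hve
    exact mem_drawWalk.2 ⟨v, b, he, (isArc_arc (C.adj_of_mem_edges he)).left_mem⟩

variable (emb) in
/-- The drawing of the edges at `v`. -/
def star (v : V) : Set (ℝ × ℝ) := ⋃ (w : V) (_ : G.Adj v w), emb.arc v w

lemma star_inter_star {C : G.Walk x x} (hC : C.IsCycle) (hv : v ∉ C.support)
    (hvC : ∀ u, G.Adj v u → u ∈ C.support) (hwC : ∀ u, G.Adj w u → u ∈ C.support) (hvw : v ≠ w) :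
    star emb v ∩ star emb w ⊆ drawWalk emb C := by
  rintro z ⟨hz, hz'⟩
  obtain ⟨a, ha, hza⟩ := mem_iUnion₂.1 hz
  obtain ⟨b, hb, hzb⟩ := mem_iUnion₂.1 hz'
  have hvb : v ≠ b := fun e => hv (e ▸ hwC b hb)
  obtain ⟨u, rfl, rfl | rfl, h⟩ := exists_vertex_of_mem_arcs ha hb (by
    intro e
    rcases Sym2.eq_iff.1 e with h | h
    exacts [hvw h.1, hvb h.1]) hza hzb
  · exact (h.elim hvw hvb).elim
  · exact (pos_mem_drawWalk hC).2 (hvC u ha)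

lemma isTripod_star [Fintype V] {C : G.Walk x x} (hC : C.IsCycle) (hiso : IsIsolating G C)
    (hv : v ∉ C.support) {R : Set (ℝ × ℝ)} (hR : IsFaceOf (drawWalk emb C) R) (hvR : emb.pos v ∈ R) :
    IsTripod (star emb v) (emb.pos v) (drawWalk emb C) R := by
  obtain ⟨hcard, hN⟩ := hiso v hv
  obtain ⟨-, -, -, -, hRf⟩ := (isFaceOf_iff (isJordan_drawWalk C hC).isClosed).1 hR
  set N := Finset.univ.filter fun w => G.Adj v w
  let e : Fin 3 ≃ N := (N.equivFinOfCardEq hcard).symm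
  have he : ∀ i, G.Adj v (e i) := fun i => (Finset.mem_filter.1 (e i).2).2
  refine ⟨fun i => emb.pos (e i), fun i => emb.arc v (e i), ?_, fun i => ⟨?_, isArc_arc (he i), ?_⟩,
    fun i j hij => subset_antisymm ?_ ?_, ?_⟩
  · exact emb.pos_injective.comp (Subtype.val_injective.comp e.injective)
  · exact (pos_mem_drawWalk hC).2 (hN _ (he i))
  · have ha := isArc_arc (emb := emb) (he i)
    refine subset_of_frontier ha.symm.isPreconnected_sdiff_left
      ⟨emb.pos v, ⟨ha.left_mem, ha.ne⟩, hvR⟩ (disjoint_left.2 ?_) hRf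
    rintro z ⟨hz, hne⟩ hzC
    obtain ⟨w, rfl, rfl | rfl, hw⟩ := exists_vertex_of_mem_drawWalk (he i)
      (fun h => hv (C.fst_mem_support_of_mem_edges h)) hz hzC
    exacts [hv hw, hne rfl]
  · rintro z ⟨hz, hz'⟩
    have hij' : (e i : V) ≠ e j := fun h => hij (e.injective (Subtype.ext h))
    obtain ⟨w, rfl, rfl | rfl, h⟩ := exists_vertex_of_mem_arcs (he i) (he j) (by
      intro h
      rcases Sym2.eq_iff.1 h with h | h
      exacts [hij' h.2, (he j).ne h.1]) hz hz'
    · rfl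
    · exact (h.elim (fun h => (he i).ne h.symm) hij').elim
  · rintro z rfl
    exact ⟨(isArc_arc (he i)).left_mem, (isArc_arc (he j)).left_mem⟩
  · refine subset_antisymm (iUnion₂_subset fun w hw => ?_)
      (iUnion_subset fun i => subset_iUnion₂_of_subset _ (he i) subset_rfl)
    have hwN : w ∈ N := Finset.mem_filter.2 ⟨Finset.mem_univ _, hw⟩
    refine subset_iUnion_of_subset (e.symm ⟨w, hwN⟩) ?_
    simp

lemma drawingOn_compl [Fintype V] {C : G.Walk x x} (hC : C.IsCycle) {S S' : Finset V}
    (hS : ∀ v ∈ S, v ∉ C.support) (hS' : ∀ v, v ∈ S' ↔ v ∉ S ∧ v ∉ C.support)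
    (hvS : ∀ v ∈ S', emb.pos v ∈ star emb v) (hN : ∀ v ∈ S', ∀ w, G.Adj v w → w ∈ C.support) :
    drawingOn emb (Hgraph C) (↑S : Set V)ᶜ = drawWalk emb C ∪ ⋃ v ∈ S', star emb v := by
  have hadj : ∀ u v, (Hgraph C).Adj u v ↔ G.Adj u v ∧ s(u, v) ∉ chordSet C := fun u v =>
    SimpleGraph.deleteEdges_adj
  refine subset_antisymm (union_subset ?_ ?_) (union_subset ?_ ?_)
  · rintro _ ⟨v, hv, rfl⟩
    by_cases hvC : v ∈ C.support
    · exact Or.inl ((pos_mem_drawWalk hC).2 hvC)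
    · have := (hS' v).2 ⟨hv, hvC⟩
      exact Or.inr (mem_biUnion this (hvS v this))
  · simp only [iUnion_subset_iff]
    intro u v h hu hv z hz
    obtain ⟨hG, hch⟩ := (hadj u v).1 h
    by_cases he : s(u, v) ∈ C.edges
    · exact Or.inl (mem_drawWalk.2 ⟨u, v, he, hz⟩)
    by_cases huC : u ∈ C.support
    · by_cases hvC : v ∈ C.support
      · refine (hch ⟨hG, he, fun w hw => ?_⟩).elim
        rcases Sym2.mem_iff.1 hw with rfl | rfl
        exacts [huC, hvC]
      · exact Or.inr (mem_biUnion ((hS' v).2 ⟨hv, hvC⟩)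
          (mem_iUnion₂.2 ⟨u, hG.symm, emb.arc_symm u v ▸ hz⟩))
    · exact Or.inr (mem_biUnion ((hS' u).2 ⟨hu, huC⟩) (mem_iUnion₂.2 ⟨v, hG, hz⟩))
  · intro z hz
    obtain ⟨a, b, hab, hz⟩ := mem_drawWalk.1 hz
    refine Or.inr ?_
    simp only [mem_iUnion]
    exact ⟨a, b, (hadj a b).2 ⟨C.adj_of_mem_edges hab, fun h => h.2.1 hab⟩,
      fun h => hS a h (C.fst_mem_support_of_mem_edges hab),
      fun h => hS b h (C.snd_mem_support_of_mem_edges hab), hz⟩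
  · refine iUnion₂_subset fun v hv z hz => ?_
    obtain ⟨w, hw, hz⟩ := mem_iUnion₂.1 hz
    obtain ⟨h1, h2⟩ := (hS' v).1 hv
    refine Or.inr ?_
    simp only [mem_iUnion]
    exact ⟨v, w, (hadj v w).2 ⟨hw, fun h => h2 (h.2.2 v (Sym2.mem_mk_left v w))⟩, h1,
      fun h => hS w h (hN v hv w hw), hz⟩

/-- The minor faces on one side of an isolating cycle. -/
theorem exists_minor_faces [Fintype V] {C : G.Walk x x} (hC : C.IsCycle) (hiso : IsIsolating G C)
    {S S' : Finset V} (hS : ∀ v ∈ S, v ∉ C.support) (hS' : ∀ v, v ∈ S' ↔ v ∉ S ∧ v ∉ C.support)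
    (hne : S'.Nonempty) {R : Set (ℝ × ℝ)} (hR : IsFaceOf (drawWalk emb C) R)
    (hS'R : ∀ v ∈ S', emb.pos v ∈ R) (hSR : ∀ v ∈ S, emb.pos v ∉ R)
    (hV : ∀ v, v ∈ Vminus emb C ∪ Vplus emb C ↔ v ∉ C.support) :
    {f | MinorFaceOf emb C (drawingOn emb (Hgraph C) (↑S : Set V)ᶜ) f}.Finite ∧
    ∃ 𝓜 : Finset (Set (ℝ × ℝ)), S'.card + 2 ≤ 𝓜.card ∧ ∀ f ∈ 𝓜, f.Nonempty ∧ f ⊆ R ∧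
      MinorFaceOf emb C (drawingOn emb (Hgraph C) (↑S : Set V)ᶜ) f := by
  have hJ := isJordan_drawWalk (emb := emb) C hC
  have hreg := hJ.isRegion hR
  have hfr := hJ.frontier_eq hR
  have hT : ∀ v ∈ S', IsTripod (star emb v) (emb.pos v) (frontier R) R := fun v hv =>
    hfr.symm ▸ isTripod_star hC hiso ((hS' v).1 hv).2 hR (hS'R v hv)
  have hTT : ∀ v ∈ S', ∀ w ∈ S', v ≠ w → star emb v ∩ star emb w ⊆ frontier R := by
    intro v hv w hw hvw
    rw [hfr]
    have hv' := ((hS' v).1 hv).2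
    have hw' := ((hS' w).1 hw).2
    exact star_inter_star hC hv' (hiso v hv').2 (hiso w hw').2 hvw
  have hD : drawingOn emb (Hgraph C) (↑S : Set V)ᶜ = frontier R ∪ ⋃ v ∈ S', star emb v := by
    rw [hfr]
    exact drawingOn_compl hC hS hS' (fun v hv => ((hT v hv).props hreg.props.2.2.2).1.1)
      fun v hv => (hiso v ((hS' v).1 hv).2).2
  rw [hD]
  refine ⟨(hreg.finite_faces hT hTT).subset fun f hf => hf.1, ?_⟩
  obtain ⟨𝓜, hcard, hM⟩ := hreg.exists_minor hne hT hTT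
  refine ⟨𝓜, hcard, fun f hf => ?_⟩
  obtain ⟨h1, h2, h3, v, ⟨hv, hvf⟩, huniq⟩ := hM f hf
  refine ⟨h1, h2, h3, v, ⟨(hV v).2 ((hS' v).1 hv).2, hvf⟩, ?_⟩
  rintro w ⟨hw, hwf⟩
  have hwC := (hV w).1 hw
  refine huniq w ⟨(hS' w).2 ⟨fun hwS => ?_, hwC⟩, hwf⟩
  rcases IsFaceOf.closure_subset hJ.isClosed hR (closure_mono h2 hwf) with h | h
  exacts [hSR w hwS h, hwC ((pos_mem_drawWalk hC).1 h)]

end Embedding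

end PlaneTopology

/-- For an essentially 4-connected plane graph `G` on `n ≥ 16` vertices with an
isolating cycle `C` and `|V⁻| ≥ 1`, `|V⁺| ≥ 1`, one has `|M⁻ ∪ M⁺| ≥ |V⁻ ∪ V⁺| + 4`. -/
theorem stmt3_minor_face_count_large
    {V : Type*} [Fintype V] {G : SimpleGraph V}
    (hn : 16 ≤ Fintype.card V)
    (h4 : EssentiallyFourConnected G) (emb : PlaneEmbedding G)
    {x : V} (C : G.Walk x x) (hC : C.IsCycle) (hiso : IsIsolating G C)
    (hVm : (Vminus emb C).Nonempty) (hVp : (Vplus emb C).Nonempty) :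
    (Vminus emb C ∪ Vplus emb C).card + 4 ≤ (Mminus emb C ∪ Mplus emb C).ncard := by
  have hVm' : ∀ v, v ∈ Vminus emb C ↔ v ∉ C.support ∧ emb.pos v ∈ insideC emb C := by
    simp [Vminus]
  have hVp' : ∀ v, v ∈ Vplus emb C ↔ v ∉ C.support ∧ v ∉ Vminus emb C := by
    simp [Vplus]
  have hV : ∀ v, v ∈ Vminus emb C ∪ Vplus emb C ↔ v ∉ C.support := by
    intro v
    rw [Finset.mem_union, hVp', hVm']
    tauto
  have hdis : Disjoint (Vminus emb C) (Vplus emb C) :=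
    Finset.disjoint_right.2 fun v hv => ((hVp' v).1 hv).2
  have hJ := PlaneTopology.isJordan_drawWalk (emb := emb) C hC
  have hoff : ∀ v, v ∉ C.support → emb.pos v ∉ drawC emb C := fun v hv h =>
    hv ((PlaneTopology.pos_mem_drawWalk hC).1 h)
  have hface : ∀ v, v ∉ C.support →
      IsFaceOf (drawC emb C) (connectedComponentIn (drawC emb C)ᶜ (emb.pos v)) := fun v hv =>
    ⟨_, hoff v hv, rfl⟩
  have hself : ∀ v, v ∉ C.support →
      emb.pos v ∈ connectedComponentIn (drawC emb C)ᶜ (emb.pos v) := fun v hv =>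
    mem_connectedComponentIn (hoff v hv)
  have hbdd : ∀ v, v ∉ C.support → (v ∈ Vminus emb C ↔
      Bornology.IsBounded (connectedComponentIn (drawC emb C)ᶜ (emb.pos v))) := fun v hv =>
    (hVm' v).trans ⟨fun h => h.2.2, fun h => ⟨hv, hoff v hv, h⟩⟩
  obtain ⟨a, ha⟩ := hVm
  obtain ⟨b, hb⟩ := hVp
  have haC := ((hVm' a).1 ha).1
  have hbC := ((hVp' b).1 hb).1
  have hRb := (hbdd a haC).1 ha
  have hSb := mt (hbdd b hbC).2 ((hVp' b).1 hb).2
  have hR := hface a haC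
  have hS := hface b hbC
  generalize connectedComponentIn (drawC emb C)ᶜ (emb.pos a) = R at hRb hR
  generalize connectedComponentIn (drawC emb C)ᶜ (emb.pos b) = S at hSb hS
  have hRS : R ≠ S := by
    rintro rfl
    exact hSb hRb
  have hRSd := (PlaneTopology.IsFaceOf.eq_or_disjoint hR hS).resolve_left hRS
  have hmR : ∀ v ∈ Vminus emb C, emb.pos v ∈ R := by
    intro v hv
    have hvC := ((hVm' v).1 hv).1
    rcases hJ.eq_or_eq hR hS hRS (hface v hvC) with h | h
    · exact h ▸ hself v hvC
    · exact (hSb (h ▸ (hbdd v hvC).1 hv)).elim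
  have hpS : ∀ v ∈ Vplus emb C, emb.pos v ∈ S := by
    intro v hv
    obtain ⟨hvC, hvm⟩ := (hVp' v).1 hv
    rcases hJ.eq_or_eq hR hS hRS (hface v hvC) with h | h
    · exact (hvm ((hbdd v hvC).2 (h ▸ hRb))).elim
    · exact h ▸ hself v hvC
  obtain ⟨hfm, 𝓜, hM, hMm⟩ := PlaneTopology.exists_minor_faces (S := Vplus emb C)
    (S' := Vminus emb C) hC hiso (fun v hv => ((hVp' v).1 hv).1)
    (fun v => by rw [hVp', hVm']; tauto) ⟨a, ha⟩ hR hmR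
    (fun v hv h => Set.disjoint_left.1 hRSd h (hpS v hv)) hV
  obtain ⟨hfp, 𝓟, hP, hPp⟩ := PlaneTopology.exists_minor_faces (S := Vminus emb C)
    (S' := Vplus emb C) hC hiso (fun v hv => ((hVm' v).1 hv).1)
    (fun v => by rw [hVp']; tauto) ⟨b, hb⟩ hS hpS
    (fun v hv h => Set.disjoint_left.1 hRSd (hmR v hv) h) hV
  have hMP : Disjoint 𝓜 𝓟 := by
    refine Finset.disjoint_left.2 fun f hf hf' => ?_
    obtain ⟨z, hz⟩ := (hMm f hf).1
    exact Set.disjoint_left.1 hRSd ((hMm f hf).2.1 hz) ((hPp f hf').2.1 hz)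
  have hsub : ((𝓜 ∪ 𝓟 : Finset (Set (ℝ × ℝ))) : Set (Set (ℝ × ℝ))) ⊆ Mminus emb C ∪ Mplus emb C := by
    intro f hf
    rcases Finset.mem_union.1 hf with h | h
    exacts [Or.inl (hMm f h).2.2, Or.inr (hPp f h).2.2]
  have hfin : (Mminus emb C ∪ Mplus emb C).Finite := hfm.union hfp
  have hle := Set.ncard_le_ncard hsub hfin
  rw [Set.ncard_coe_finset, Finset.card_union_of_disjoint hMP] at hle
  rw [Finset.card_union_of_disjoint hdis]
  omega

end
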